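/- Let X ⊂ int(𝔸) be an f-invariant essential annular continuum with (V)₁ unbounded from below and from above. Assume: (a) there exists ρ < 0 such that for all points x, y ∈ X̃ accessible from Ũ₊ one has k(f̃ⁿ(x), y)/n → ρ as n → ∞, and inf ρ_mes(f̃, X) > 0; (b) (f̃(x))₁ ≥ (x)₁ + 1 for every x ∈ X̃; (c) M > 1 is such that for every x ∈ V, if every hair γ of V with γ(1) = x satisfies diam((γ)₁) > M, then (f̃(x))₁ ≥ (x)₁ + 1/2; (d) R > 1 is such that every hair γ whose image is contained in V⁻ with (γ(1))₁ ≥ R satisfies −M ∈ (γ)₁. Then for every k ∈ ℤ and every crosscut c of Ũ₊ whose interior is contained in (V+k)⁻ and with min (c)₁ ≥ R + k, the image f̃(c) is a crosscut of Ũ₊ whose interior is contained in (V+k)⁻ and with min (f̃(c))₁ > R + k. -/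

import Mathlib

open Set Function MeasureTheory Filter Topology

noncomputable section

/-- The vertical fiber `[-1,1]`. -/
abbrev II : Set ℝ := Set.Icc (-1 : ℝ) 1

/-- The universal cover `ℝ × [-1,1]` of the annulus. -/
abbrev Strip : Type := ℝ × II

/-- The compact annulus `(ℝ/ℤ) × [-1,1]`. -/
abbrev Ann : Type := AddCircle (1 : ℝ) × II

/-- The covering projection `π`. -/
def pr (z : Strip) : Ann := ((z.1 : AddCircle (1 : ℝ)), z.2)

/-- The deck transformation `T^k`. -/
def shiftPt (k : ℤ) (z : Strip) : Strip := (z.1 + k, z.2)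

/-- `S + k`, the image of `S` under `T^k`. -/
def shiftSet (k : ℤ) (S : Set Strip) : Set Strip := shiftPt k '' S

/-- `f` is isotopic to the identity. -/
def IsotopicToId (f : Ann → Ann) : Prop :=
  ∃ H : ℝ → Ann → Ann, Continuous (fun p : ℝ × Ann => H p.1 p.2) ∧
    (∀ t : ℝ, Function.Bijective (H t)) ∧ H 0 = id ∧ H 1 = f

/-- `F` is a lift of `f` commuting with the deck transformation. -/
def IsLift (f : Ann → Ann) (F : Strip → Strip) : Prop :=
  (∀ z, pr (F z) = f (pr z)) ∧ (∀ z, F (shiftPt 1 z) = shiftPt 1 (F z))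

/-- `X` is an essential annular continuum with complementary components `Um`, `Up`. -/
structure IsEAC (X Um Up : Set Ann) : Prop where
  compact : IsCompact X
  connected : IsConnected X
  inInterior : ∀ p ∈ X, ((p.2 : ℝ)) ∈ Set.Ioo (-1 : ℝ) 1
  hUm : Um = connectedComponentIn Xᶜ ((0 : AddCircle (1 : ℝ)), ⟨-1, le_rfl, by norm_num⟩)
  hUp : Up = connectedComponentIn Xᶜ ((0 : AddCircle (1 : ℝ)), ⟨1, by norm_num, le_rfl⟩)
  cover : Xᶜ = Um ∪ Up
  ne : Um ≠ Up

/-- An arc `γ : [0,1] → U ∪ {p}` with `γ([0,1)) ⊂ U` and `γ(1) = p`. -/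
def IsArcTo (U : Set Strip) (γ : unitInterval → Strip) (p : Strip) : Prop :=
  Continuous γ ∧ Function.Injective γ ∧ (∀ t, t ≠ 1 → γ t ∈ U) ∧ γ 1 = p

/-- `p` is accessible from `U`. -/
def AccFrom (U : Set Strip) (p : Strip) : Prop := ∃ γ, IsArcTo U γ p

/-- The order `≺` on accessible points, with access arcs starting on `ℝ × {b}`. -/
def PrecB (b : ℝ) (U : Set Strip) (x x' : Strip) : Prop :=
  ∃ γ γ' : unitInterval → Strip,
    IsArcTo U γ x ∧ IsArcTo U γ' x' ∧
    ((γ 0).2 : ℝ) = b ∧ ((γ' 0).2 : ℝ) = b ∧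
    Disjoint (range γ) (range γ') ∧ (γ 0).1 < (γ' 0).1

/-- `k = k(x,y)` is the unique integer with `T^k(y) ⪯ x ≺ T^{k+1}(y)`. -/
def AccIdxB (b : ℝ) (U : Set Strip) (x y : Strip) (k : ℤ) : Prop :=
  (shiftPt k y = x ∨ PrecB b U (shiftPt k y) x) ∧ PrecB b U x (shiftPt (k + 1) y)

/-- `ρ` is the prime end rotation number of the lift `F` as seen from `U`
(access arcs starting at height `b`): `k(Fⁿ(x), y)/n → ρ` for all accessible `x, y`. -/
def PrimeEndRotB (b : ℝ) (U Xt : Set Strip) (F : Strip → Strip) (ρ : ℝ) : Prop :=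
  ∀ x ∈ Xt, ∀ y ∈ Xt, AccFrom U x → AccFrom U y →
    ∀ k : ℕ → ℤ, (∀ n : ℕ, AccIdxB b U (F^[n] x) y (k n)) →
      Tendsto (fun n : ℕ => (k n : ℝ) / (n : ℝ)) atTop (𝓝 ρ)

/-- The measure-theoretic rotation set `ρ_mes(g̃, X)`, where `φ` is the displacement
function of the lift `g̃` (pushed down to the annulus). -/
def rotMes (g : Ann → Ann) (φ : Ann → ℝ) (X : Set Ann) : Set ℝ :=
  {r | ∃ μ : Measure Ann, IsProbabilityMeasure μ ∧ Measure.map g μ = μ ∧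
    μ Xᶜ = 0 ∧ ∫ a, φ a ∂μ = r}

/-- A point in the interior of the top boundary segment `(0,1) × {1}`. -/
def topSeg : Strip := ((1 : ℝ) / 2, ⟨1, by norm_num, le_rfl⟩)

/-- `β' = β ∖ {x₀} = {0} × (η, 1]`. -/
def betaP (η : ℝ) : Set Strip := {z : Strip | z.1 = 0 ∧ η < (z.2 : ℝ)}

/-- `η = max{y : (0,y) ∈ X̃}`. -/
def etaSpec (Xt : Set Strip) (η : ℝ) : Prop :=
  IsGreatest {y : ℝ | ∃ z ∈ Xt, z.1 = 0 ∧ (z.2 : ℝ) = y} η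

/-- The fundamental region `V`: the closure, relative to `Ũ₊`, of the connected
component of `Ũ₊ ∖ (β' ∪ (β' + 1))` containing the segment `(0,1) × {1}`. -/
def Vset (Utp : Set Strip) (η : ℝ) : Set Strip :=
  Utp ∩ closure (connectedComponentIn (Utp \ (betaP η ∪ shiftSet 1 (betaP η))) topSeg)

/-- A hair of `W`: an arc in `W` starting on `ℝ × {1}`. -/
def IsHair (W : Set Strip) (γ : unitInterval → Strip) : Prop :=
  Continuous γ ∧ Function.Injective γ ∧ ((γ 0).2 : ℝ) = 1 ∧ ∀ t, γ t ∈ W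

/-- `(γ)₁`, the projection of the image of `γ` to the first coordinate. -/
def proj1 (γ : unitInterval → Strip) : Set ℝ := range fun t => (γ t).1

/-- `(V + k)⁻ = ⋃_{j ≤ k} (V + j)`. -/
def VMinus (k : ℤ) (V : Set Strip) : Set Strip := ⋃ j ∈ Iic k, shiftSet j V

/-- `(V + k)⁺ = ⋃_{j ≥ k} (V + j)`. -/
def VPlus (k : ℤ) (V : Set Strip) : Set Strip := ⋃ j ∈ Ici k, shiftSet j V

/-- A crosscut of `Ũ₊`: an arc with endpoints on `X̃` and interior in `Ũ₊`. -/
def IsCrosscut (Utp Xt : Set Strip) (c : unitInterval → Strip) : Prop :=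
  Continuous c ∧ Function.Injective c ∧ c 0 ∈ Xt ∧ c 1 ∈ Xt ∧
    ∀ t, t ≠ 0 → t ≠ 1 → c t ∈ Utp

/-- `F^n` for `n : ℤ`. -/
def iterZ (F : Strip ≃ₜ Strip) (n : ℤ) : Strip → Strip := fun z => (F.toEquiv ^ n) z

end


def IsAng (w : ℂ) (θ : ℝ) : Prop := w = (‖w‖ : ℂ) * Complex.exp (θ * Complex.I)

theorem IsAng.im {w : ℂ} {θ : ℝ} (h : IsAng w θ) : w.im = ‖w‖ * Real.sin θ := by
  have := congrArg Complex.im h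
  rw [Complex.im_ofReal_mul, Complex.exp_ofReal_mul_I_im] at this
  exact this

theorem IsAng.re {w : ℂ} {θ : ℝ} (h : IsAng w θ) : w.re = ‖w‖ * Real.cos θ := by
  have := congrArg Complex.re h
  rw [Complex.re_ofReal_mul, Complex.exp_ofReal_mul_I_re] at this
  exact this

theorem isAng_arg (w : ℂ) : IsAng w (Complex.arg w) :=
  (Complex.norm_mul_exp_arg_mul_I w).symm

theorem IsAng.mul {w v : ℂ} {θ θ' : ℝ} (h : IsAng w θ) (h' : IsAng v θ') :
    IsAng (w * v) (θ + θ') := by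
  unfold IsAng at *
  rw [norm_mul]
  push_cast
  rw [add_mul, Complex.exp_add]
  calc w * v = ((‖w‖ : ℂ) * Complex.exp (θ * Complex.I)) * ((‖v‖ : ℂ) * Complex.exp (θ' * Complex.I)) := by
        rw [← h, ← h']
    _ = _ := by ring

theorem IsAng.neg {w : ℂ} {θ : ℝ} (h : IsAng w θ) : IsAng (-w) (θ + Real.pi) := by
  have h1 : IsAng (-1) Real.pi := by
    unfold IsAng; simp
  have := h.mul h1
  simpa using this

theorem IsAng.neg' {w : ℂ} {θ : ℝ} (h : IsAng w θ) : IsAng (-w) (θ - Real.pi) := by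
  have h1 : IsAng (-1) (-Real.pi) := by
    unfold IsAng; simp [Complex.exp_neg]
  have := h.mul h1
  simpa [sub_eq_add_neg] using this

theorem IsAng.unique {w : ℂ} {θ θ' : ℝ} (hw : w ≠ 0) (h : IsAng w θ) (h' : IsAng w θ') :
    ∃ n : ℤ, θ = θ' + n * (2 * Real.pi) := by
  have h2 : Complex.exp (θ * Complex.I) = Complex.exp (θ' * Complex.I) := by
    have : (‖w‖ : ℂ) ≠ 0 := by simpa using hw
    apply mul_left_cancel₀ this
    rw [← h, ← h']
  rw [Complex.exp_eq_exp_iff_exists_int] at h2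
  obtain ⟨n, hn⟩ := h2
  refine ⟨n, ?_⟩
  have := congrArg Complex.im hn
  simpa using this

theorem sq_lift (G : unitInterval × unitInterval → ℂ) (hG : Continuous G) (hne : ∀ p, G p ≠ 0)
    (θ0 : ℝ) (h0 : IsAng (G (0, 0)) θ0) :
    ∃ θ : unitInterval × unitInterval → ℝ, Continuous θ ∧ θ (0, 0) = θ0 ∧ ∀ p, IsAng (G p) (θ p) := by
  have hn : ∀ p, G p / ‖G p‖ ∈ Submonoid.unitSphere ℂ := by
    intro p
    have : ‖G p‖ ≠ 0 := by simpa using hne p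
    simp [Submonoid.unitSphere, this]
  let H : C(unitInterval × unitInterval, Circle) :=
    ⟨fun p => ⟨G p / ‖G p‖, hn p⟩, by
      refine Continuous.subtype_mk ?_ _
      refine hG.div (by fun_prop) ?_
      intro p
      simpa using hne p⟩
  have key : ∀ p t, Circle.exp t = H p ↔ IsAng (G p) t := by
    intro p t
    have hp : (‖G p‖ : ℂ) ≠ 0 := by simpa using hne p
    rw [← Circle.coe_inj, Circle.coe_exp]
    change _ = G p / ‖G p‖ ↔ _
    unfold IsAng
    rw [eq_div_iff hp, mul_comm, eq_comm]
  let γ : C(unitInterval, Circle) := ⟨fun t => H (0, t), by fun_prop⟩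
  have hγ0 : γ 0 = Circle.exp θ0 := ((key (0,0) θ0).2 h0).symm
  let Γ := Circle.isCoveringMap_exp.liftPath γ θ0 hγ0
  have hΓ : Circle.exp ∘ Γ = γ := Circle.isCoveringMap_exp.liftPath_lifts γ θ0 hγ0
  have hΓ0 : Γ 0 = θ0 := Circle.isCoveringMap_exp.liftPath_zero γ θ0 hγ0
  have hH0 : ∀ a, H (0, a) = Circle.exp (Γ a) := fun a => (congrFun hΓ a).symm
  let L := Circle.isCoveringMap_exp.liftHomotopy H Γ hH0
  have hL : Circle.exp ∘ L = H := Circle.isCoveringMap_exp.liftHomotopy_lifts H Γ hH0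
  have hL0 : L (0, 0) = Γ 0 := Circle.isCoveringMap_exp.liftHomotopy_zero H Γ hH0 0
  exact ⟨L, L.continuous, hL0.trans hΓ0, fun p => (key p _).1 (congrFun hL p)⟩

theorem ang_const {Y : Type*} [TopologicalSpace Y] {S : Set Y} (hS : IsPreconnected S) {w : Y → ℂ}
    {θ θ' : Y → ℝ}
    (hw : ∀ x ∈ S, w x ≠ 0) (hθ : ContinuousOn θ S) (hθ' : ContinuousOn θ' S)
    (h : ∀ x ∈ S, IsAng (w x) (θ x)) (h' : ∀ x ∈ S, IsAng (w x) (θ' x)) {x y : Y} (hx : x ∈ S)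
    (hy : y ∈ S) : θ x - θ' x = θ y - θ' y := by
  have hd : ContinuousOn (fun x => θ x - θ' x) S := hθ.sub hθ'
  have hinteg : ∀ x ∈ S, ∃ n : ℤ, θ x - θ' x = n * (2 * Real.pi) := by
    intro x hx
    obtain ⟨n, hn⟩ := IsAng.unique (hw x hx) (h x hx) (h' x hx)
    exact ⟨n, by linarith⟩
  have main : ∀ x ∈ S, ∀ᶠ y in 𝓝[S] x, θ x - θ' x = θ y - θ' y := by
    intro x hx
    have h1 := hd x hx
    have h2 := h1.eventually (Metric.ball_mem_nhds _ Real.pi_pos)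
    filter_upwards [h2, self_mem_nhdsWithin] with y hy hyS
    obtain ⟨n, hn⟩ := hinteg x hx
    obtain ⟨m, hm⟩ := hinteg y hyS
    simp only [Metric.mem_ball, Real.dist_eq] at hy
    rw [hn, hm] at hy
    rw [hn, hm]
    have : n = m := by
      rw [← sub_mul, abs_mul, abs_of_pos (by positivity : 0 < 2 * Real.pi)] at hy
      have h3 : |(m : ℝ) - n| < 1 := by
        by_contra hcon
        push Not at hcon
        nlinarith [Real.pi_pos]
      have h4 : |m - n| < 1 := by exact_mod_cast h3
      have := Int.abs_lt_one_iff.1 h4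
      omega
    rw [this]
  exact hS.induction₂ (fun x y => θ x - θ' x = θ y - θ' y)
    (fun x hx => main x hx) (fun _ _ _ _ _ _ => Eq.trans) (fun _ _ _ _ => Eq.symm) hx hy

theorem ang_upper {Y : Type*} [TopologicalSpace Y] {S : Set Y} (hS : IsPreconnected S) {w : Y → ℂ}
    {θ : Y → ℝ} (hw : ∀ x ∈ S, w x ≠ 0) (hθ : ContinuousOn θ S)
    (h : ∀ x ∈ S, IsAng (w x) (θ x)) (him : ∀ x ∈ S, 0 ≤ (w x).im)
    {x : Y} (hx : x ∈ S) (n : ℤ) (hx0 : θ x ∈ Icc (n * (2 * Real.pi)) (n * (2 * Real.pi) + Real.pi))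
    {y : Y} (hy : y ∈ S) : θ y ∈ Icc (n * (2 * Real.pi)) (n * (2 * Real.pi) + Real.pi) := by
  have hsin : ∀ y ∈ S, 0 ≤ Real.sin (θ y - n * (2 * Real.pi)) := by
    intro y hy
    rw [Real.sin_sub_int_mul_two_pi]
    have h1 := (h y hy).im
    have h2 := him y hy
    have h3 : 0 < ‖w y‖ := norm_pos_iff.2 (hw y hy)
    by_contra hc
    push Not at hc
    nlinarith
  have hc : (θ '' S).OrdConnected := (hS.image θ hθ).ordConnected
  have pp := Real.pi_pos
  constructor
  · by_contra hcon
    push Not at hcon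
    obtain ⟨z, hz, hzz⟩ := hc.out ⟨y, hy, rfl⟩ ⟨x, hx, rfl⟩
      (show max (θ y) (n * (2 * Real.pi) - Real.pi / 2) ∈ Icc (θ y) (θ x) from
        ⟨le_max_left _ _, max_le (by linarith [hx0.1]) (by linarith [hx0.1])⟩)
    have := hsin z hz
    have h4 : Real.sin (θ z - n * (2 * Real.pi)) < 0 := by
      apply Real.sin_neg_of_neg_of_neg_pi_lt
      · rw [hzz, sub_neg]; exact max_lt hcon (by linarith)
      · rw [hzz]; linarith [le_max_right (θ y) (n * (2 * Real.pi) - Real.pi / 2)]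
    linarith
  · by_contra hcon
    push Not at hcon
    obtain ⟨z, hz, hzz⟩ := hc.out ⟨x, hx, rfl⟩ ⟨y, hy, rfl⟩
      (show min (θ y) (n * (2 * Real.pi) + 3 * Real.pi / 2) ∈ Icc (θ x) (θ y) from
        ⟨le_min (by linarith [hx0.2]) (by linarith [hx0.2]), min_le_left _ _⟩)
    have := hsin z hz
    have h4 : Real.sin (θ z - n * (2 * Real.pi) - 2 * Real.pi) < 0 := by
      apply Real.sin_neg_of_neg_of_neg_pi_lt
      · rw [hzz]; linarith [min_le_right (θ y) (n * (2 * Real.pi) + 3 * Real.pi / 2)]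
      · rw [hzz]
        have := lt_min hcon (show n * (2 * Real.pi) + Real.pi < n * (2 * Real.pi) + 3 * Real.pi / 2 by linarith)
        linarith
    rw [Real.sin_sub_two_pi] at h4
    linarith

theorem ang_lower {Y : Type*} [TopologicalSpace Y] {S : Set Y} (hS : IsPreconnected S) {w : Y → ℂ}
    {θ : Y → ℝ} (hw : ∀ x ∈ S, w x ≠ 0) (hθ : ContinuousOn θ S)
    (h : ∀ x ∈ S, IsAng (w x) (θ x)) (him : ∀ x ∈ S, (w x).im ≤ 0)
    {x : Y} (hx : x ∈ S) (n : ℤ) (hx0 : θ x ∈ Icc (n * (2 * Real.pi) - Real.pi) (n * (2 * Real.pi)))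
    {y : Y} (hy : y ∈ S) : θ y ∈ Icc (n * (2 * Real.pi) - Real.pi) (n * (2 * Real.pi)) := by
  have := ang_upper (w := fun x => - w x) (θ := fun x => θ x + Real.pi) hS
    (fun x hx => neg_ne_zero.2 (hw x hx)) (by fun_prop) (fun x hx => (h x hx).neg)
    (fun x hx => by simpa using him x hx) hx n ⟨by linarith [hx0.1], by linarith [hx0.2]⟩ hy
  exact ⟨by linarith [this.1], by linarith [this.2]⟩

/-- An angle of a point in the open upper half plane, within `π` of `(0,π)`. -/
theorem ang_eq_of_Icc {w : ℂ} (hw : w ≠ 0) {θ θ' : ℝ} (h : IsAng w θ) (h' : IsAng w θ')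
    (h1 : θ ∈ Icc 0 Real.pi) (h2 : θ' ∈ Icc 0 Real.pi) : θ = θ' := by
  obtain ⟨n, hn⟩ := IsAng.unique hw h h'
  have pp := Real.pi_pos
  have h3 : (n : ℝ) < 1 := by
    by_contra hc; push Not at hc; nlinarith [h1.1, h1.2, h2.1, h2.2]
  have h4 : (-1 : ℝ) < n := by
    by_contra hc; push Not at hc; nlinarith [h1.1, h1.2, h2.1, h2.2]
  have h5 : n < 1 := by exact_mod_cast h3
  have h6 : -1 < n := by exact_mod_cast h4
  have : n = 0 := by omega
  simpa [this] using hn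


/-- The annulus embedded as a round annulus in the plane. -/
noncomputable def emb (p : Ann) : ℂ := (((p.2 : ℝ) + 2 : ℝ) : ℂ) * (AddCircle.toCircle p.1 : ℂ)

theorem emb_continuous : Continuous emb := by
  unfold emb
  have := AddCircle.continuous_toCircle (T := (1:ℝ))
  fun_prop

theorem emb_norm (p : Ann) : ‖emb p‖ = (p.2 : ℝ) + 2 := by
  have := p.2.2.1
  unfold emb
  rw [norm_mul, Circle.norm_coe, mul_one, Complex.norm_real, Real.norm_eq_abs, abs_of_pos]
  linarith

theorem emb_injective : Injective emb := by
  intro p q h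
  have h1 : (p.2 : ℝ) = q.2 := by
    have := congrArg norm h
    rw [emb_norm, emb_norm] at this
    linarith
  have h2 : p.1 = q.1 := by
    unfold emb at h
    rw [h1] at h
    have h3 : (((q.2 : ℝ) + 2 : ℝ) : ℂ) ≠ 0 := by
      have := q.2.2.1
      rw [Complex.ofReal_ne_zero]
      linarith
    have h4 := mul_left_cancel₀ h3 h
    exact AddCircle.injective_toCircle one_ne_zero (Circle.coe_injective h4)
  exact Prod.ext h2 (Subtype.ext h1)

theorem emb_range {z : ℂ} (h1 : 1 ≤ ‖z‖) (h3 : ‖z‖ ≤ 3) : z ∈ range emb := by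
  have hz : (‖z‖ : ℂ) ≠ 0 := by
    rw [Complex.ofReal_ne_zero]; linarith
  have hm : z / ‖z‖ ∈ Submonoid.unitSphere ℂ := by
    have : ‖z‖ ≠ 0 := by linarith
    simp [Submonoid.unitSphere, this]
  obtain ⟨u, hu⟩ := (AddCircle.homeomorphCircle (T := (1:ℝ)) one_ne_zero).surjective ⟨z / ‖z‖, hm⟩
  rw [AddCircle.homeomorphCircle_apply] at hu
  refine ⟨(u, ⟨‖z‖ - 2, by constructor <;> linarith⟩), ?_⟩
  unfold emb
  simp only [hu]
  push_cast
  rw [sub_add_cancel, mul_div_cancel₀ _ hz]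

theorem bdry_inv (h : Ann → Ann) (hc : Continuous h) (hb : Bijective h) (p : Ann)
    (hp : (p.2 : ℝ) = 1) : ((h p).2 : ℝ) = 1 ∨ ((h p).2 : ℝ) = -1 := by
  by_contra hcon
  push Not at hcon
  obtain ⟨hc1, hc2⟩ := hcon
  have hq1 : ((h p).2 : ℝ) < 1 := lt_of_le_of_ne (h p).2.2.2 hc1
  have hq2 : -1 < ((h p).2 : ℝ) := lt_of_le_of_ne (h p).2.2.1 (Ne.symm hc2)
  let hh : Ann ≃ₜ Ann := Continuous.homeoOfEquivCompactToT2 (f := Equiv.ofBijective h hb) hc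
  have hhh : ∀ x, hh x = h x := fun x => rfl
  have hemb : IsClosedEmbedding emb := emb_continuous.isClosedEmbedding emb_injective
  let e : Ann ≃ₜ range emb := hemb.isEmbedding.toHomeomorph
  have he : ∀ x, (e x : ℂ) = emb x := fun x => rfl
  have hes : ∀ z : range emb, emb (e.symm z) = z := by
    intro z
    rw [← he, e.apply_symm_apply]
  set q := emb (h p) with hq
  have hqn : ‖q‖ = ((h p).2 : ℝ) + 2 := emb_norm _
  have hpn : ‖emb p‖ = 3 := by rw [emb_norm, hp]; norm_num
  -- the pulled-back map
  let g : range emb → ℂ := fun z => emb (hh.symm (e.symm z))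
  have hg : Continuous g := emb_continuous.comp (hh.symm.continuous.comp e.symm.continuous)
  have hgq : g ⟨q, mem_range_self _⟩ = emb p := by
    have : e.symm ⟨q, mem_range_self _⟩ = h p := by
      rw [Homeomorph.symm_apply_eq]; rfl
    simp only [g, this]
    rw [← hhh, Homeomorph.symm_apply_apply]
  obtain ⟨d, hd, hdd⟩ := Metric.continuous_iff.1 hg ⟨q, mem_range_self _⟩ 1 one_pos
  obtain ⟨r, hr0, hr⟩ : ∃ r : ℝ, 0 < r ∧ r < d ∧ r < 1 - ((h p).2 : ℝ) ∧ r < ((h p).2 : ℝ) + 1 := by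
    have : 0 < min d (min (1 - ((h p).2 : ℝ)) (((h p).2 : ℝ) + 1)) := by
      refine lt_min hd (lt_min ?_ ?_) <;> linarith
    obtain ⟨r, h1, h2⟩ := exists_between this
    simp only [lt_min_iff] at h2
    exact ⟨r, h1, h2.1, h2.2.1, h2.2.2⟩
  obtain ⟨hrd, hr1, hr2⟩ := hr
  let l0 : unitInterval → ℂ := fun t => q + r * Complex.exp ((2 * Real.pi * (t : ℝ) : ℝ) * Complex.I)
  have hl0d : ∀ t, ‖l0 t - q‖ = r := by
    intro t
    simp only [l0, add_sub_cancel_left, norm_mul, Complex.norm_exp_ofReal_mul_I, mul_one,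
      Complex.norm_real, Real.norm_eq_abs, abs_of_pos hr0]
  have hl0r : ∀ t, l0 t ∈ range emb := by
    intro t
    have h1 := norm_sub_norm_le q (l0 t)
    have h2 := norm_sub_norm_le (l0 t) q
    rw [norm_sub_rev, hl0d] at h1
    rw [hl0d] at h2
    apply emb_range <;> linarith
  have hl0c : Continuous l0 := by fun_prop
  let l : unitInterval → ℂ := fun t => g ⟨l0 t, hl0r t⟩
  have hlc : Continuous l := hg.comp (hl0c.subtype_mk _)
  have hlp : ∀ t, ‖l t - emb p‖ < 1 := by
    intro t
    have := hdd ⟨l0 t, hl0r t⟩ (by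
      rw [Subtype.dist_eq, dist_eq_norm]; rw [hl0d]; exact hrd)
    rwa [hgq, dist_eq_norm] at this
  have hlne : ∀ t, l t ≠ emb p := by
    intro t ht
    have h1 : hh.symm (e.symm ⟨l0 t, hl0r t⟩) = p := emb_injective ht
    rw [Homeomorph.symm_apply_eq, Homeomorph.symm_apply_eq] at h1
    have h2 : l0 t = q := congrArg Subtype.val h1
    have := hl0d t
    rw [h2, sub_self, norm_zero] at this
    linarith
  have hln : ∀ t, ‖l t‖ ≤ 3 := by
    intro t
    simp only [l, g]
    rw [emb_norm]
    have := (hh.symm (e.symm ⟨l0 t, hl0r t⟩)).2.2.2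
    linarith
  let c0 : ℂ := ((5 / 6 : ℝ) : ℂ) * emb p
  have hc0 : ‖c0‖ = 5 / 2 := by
    simp only [c0, norm_mul, hpn, Complex.norm_real]
    norm_num
  have hc0p : ‖c0 - emb p‖ = 1 / 2 := by
    have : c0 - emb p = ((-1 / 6 : ℝ) : ℂ) * emb p := by
      simp only [c0]; push_cast; ring
    rw [this, norm_mul, hpn, Complex.norm_real]
    norm_num
  let K : unitInterval × unitInterval → ℂ :=
    fun s => ((1 - (s.1 : ℝ) : ℝ) : ℂ) * l s.2 + ((s.1 : ℝ) : ℂ) * c0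
  have hKc : Continuous K := by
    simp only [K]
    fun_prop
  have hK3 : ∀ s, ‖K s‖ ≤ (1 - (s.1 : ℝ)) * ‖l s.2‖ + (s.1 : ℝ) * (5 / 2) := by
    intro s
    have h0 := s.1.2.1
    have h1 := s.1.2.2
    calc ‖K s‖ ≤ _ := norm_add_le _ _
      _ = _ := by
        rw [norm_mul, norm_mul, hc0, Complex.norm_real, Complex.norm_real, Real.norm_of_nonneg h0,
          Real.norm_of_nonneg (by linarith)]
  have hKr : ∀ s, K s ∈ range emb := by
    intro s
    have h0 := s.1.2.1
    have h1 := s.1.2.2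
    apply emb_range
    · have h2 : K s - emb p = ((1 - (s.1 : ℝ) : ℝ) : ℂ) * (l s.2 - emb p) + ((s.1 : ℝ) : ℂ) * (c0 - emb p) := by
        simp only [K]; push_cast; ring
      have h3 : ‖K s - emb p‖ ≤ (1 - (s.1 : ℝ)) * ‖l s.2 - emb p‖ + (s.1 : ℝ) * (1 / 2) := by
        rw [h2]
        refine (norm_add_le _ _).trans (le_of_eq ?_)
        rw [norm_mul, norm_mul, hc0p, Complex.norm_real, Complex.norm_real, Real.norm_of_nonneg h0,
          Real.norm_of_nonneg (by linarith)]
      have h4 := norm_sub_norm_le (emb p) (K s)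
      rw [norm_sub_rev, hpn] at h4
      nlinarith [hlp s.2]
    · nlinarith [hK3 s, hln s.2]
  have hKp : ∀ s, K s ≠ emb p := by
    intro s hs
    have h0 := s.1.2.1
    have h1 := s.1.2.2
    rcases h0.eq_or_lt with h | h
    · apply hlne s.2
      rw [← hs]
      simp only [K]
      rw [← h]; simp
    · have := hK3 s
      rw [hs, hpn] at this
      nlinarith [hln s.2]
  let G : unitInterval × unitInterval → ℂ := fun s => emb (h (e.symm ⟨K s, hKr s⟩)) - q
  have hGc : Continuous G :=
    (emb_continuous.comp (hc.comp (e.symm.continuous.comp (hKc.subtype_mk _)))).sub continuous_const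
  have hGne : ∀ s, G s ≠ 0 := by
    intro s hs
    have h1 := hb.1 (emb_injective (sub_eq_zero.1 hs))
    rw [Homeomorph.symm_apply_eq] at h1
    exact hKp s (congrArg Subtype.val h1)
  have hG0 : ∀ t, G (0, t) = r * Complex.exp ((2 * Real.pi * (t : ℝ) : ℝ) * Complex.I) := by
    intro t
    have h1 : (⟨K (0, t), hKr (0, t)⟩ : range emb) = e (hh.symm (e.symm ⟨l0 t, hl0r t⟩)) := by
      apply Subtype.ext
      simp [K, l, g, he]
    simp only [G]
    rw [h1, Homeomorph.symm_apply_apply, ← hhh, Homeomorph.apply_symm_apply, hes]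
    simp [l0]
  have hGang : ∀ t : unitInterval, IsAng (G (0, t)) (2 * Real.pi * (t : ℝ)) := by
    intro t
    unfold IsAng
    rw [hG0, norm_mul, Complex.norm_exp_ofReal_mul_I, Complex.norm_real, Real.norm_of_nonneg hr0.le]
    simp
  obtain ⟨θ, hθc, hθ0, hθ⟩ := sq_lift G hGc hGne 0 (by simpa using hGang 0)
  have e1 := ang_const (w := fun t : unitInterval => G (0, t)) (θ := fun t => θ (0, t))
    (θ' := fun t => 2 * Real.pi * (t : ℝ)) isPreconnected_univ (fun t _ => hGne _) (by fun_prop)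
    (by fun_prop) (fun t _ => hθ _) (fun t _ => hGang t) (mem_univ 0) (mem_univ 1)
  have hG01 : ∀ s, G (s, 0) = G (s, 1) := by
    intro s
    have : K (s, 0) = K (s, 1) := by
      have : l0 0 = l0 1 := by
        simp [l0]
      simp only [K, l, this]
    simp only [G, this]
  have e2 := ang_const (w := fun s : unitInterval => G (s, 0)) (θ := fun s => θ (s, 0))
    (θ' := fun s => θ (s, 1)) isPreconnected_univ (fun t _ => hGne _) (by fun_prop)
    (by fun_prop) (fun t _ => hθ _) (fun t _ => by rw [hG01]; exact hθ _) (mem_univ 0) (mem_univ 1)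
  have hG1 : ∀ t, G (1, t) = G (1, 0) := by
    intro t
    have : K (1, t) = K (1, 0) := by simp [K]
    simp only [G, this]
  have e3 := ang_const (w := fun t : unitInterval => G (1, t)) (θ := fun t => θ (1, t))
    (θ' := fun t => θ (1, 0)) isPreconnected_univ (fun t _ => hGne _) (by fun_prop)
    (by fun_prop) (fun t _ => hθ _) (fun t _ => by rw [hG1]; exact hθ _) (mem_univ 0) (mem_univ 1)
  simp at e1 e2 e3
  have := Real.pi_pos
  linarith

theorem iso_top (f : Ann → Ann) (hf : IsotopicToId f) (p : Ann) (hp : (p.2 : ℝ) = 1) :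
    ((f p).2 : ℝ) = 1 := by
  obtain ⟨H, hHc, hHb, hH0, hH1⟩ := hf
  have h1 : ∀ t, ((H t p).2 : ℝ) = 1 ∨ ((H t p).2 : ℝ) = -1 := by
    intro t
    refine bdry_inv (H t) ?_ (hHb t) p hp
    exact hHc.comp (by fun_prop : Continuous fun a : Ann => (t, a))
  have hc : Continuous fun t : ℝ => ((H t p).2 : ℝ) := by
    have : Continuous fun t : ℝ => H t p := hHc.comp (by fun_prop : Continuous fun t : ℝ => (t, p))
    fun_prop
  rcases h1 1 with h | h
  · rwa [hH1] at h
  · exfalso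
    have hoc : (range fun t : ℝ => ((H t p).2 : ℝ)).OrdConnected :=
      (isPreconnected_range hc).ordConnected
    obtain ⟨t, ht⟩ := hoc.out ⟨1, rfl⟩ ⟨0, rfl⟩ (show (0 : ℝ) ∈ Icc _ _ by
      simp only [h, hH0, id, hp]; constructor <;> norm_num)
    simp only at ht
    rcases h1 t with h | h <;> rw [ht] at h <;> norm_num at h


theorem II_preconnected : PreconnectedSpace II := Subtype.preconnectedSpace isPreconnected_Icc

theorem circle_preconnected : PreconnectedSpace (AddCircle (1 : ℝ)) := by
  refine ⟨?_⟩
  have : Continuous ((↑) : ℝ → AddCircle (1 : ℝ)) := AddCircle.continuous_mk' 1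
  have h := isPreconnected_range this
  rwa [Function.Surjective.range_eq (QuotientAddGroup.mk_surjective)] at h

theorem pr_continuous : Continuous pr := by
  have : Continuous ((↑) : ℝ → AddCircle (1 : ℝ)) := AddCircle.continuous_mk' 1
  unfold pr
  fun_prop

theorem pr_open : IsOpenMap pr := by
  have : IsOpenMap ((↑) : ℝ → AddCircle (1 : ℝ)) := QuotientAddGroup.isOpenMap_coe
  exact this.prodMap IsOpenMap.id

theorem pr_surj : Surjective pr := by
  rintro ⟨u, v⟩
  obtain ⟨x, hx⟩ := QuotientAddGroup.mk_surjective u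
  exact ⟨(x, v), by unfold pr; simp only; exact Prod.ext hx rfl⟩

theorem pr_shift (k : ℤ) (z : Strip) : pr (shiftPt k z) = pr z := by
  unfold pr shiftPt
  refine Prod.ext ?_ rfl
  simp only
  rw [AddCircle.coe_add]
  have : ((k : ℝ) : AddCircle (1 : ℝ)) = 0 := by
    rw [AddCircle.coe_eq_zero_iff]
    exact ⟨k, by simp⟩
  rw [this, add_zero]

theorem pr_eq {z w : Strip} (h : pr z = pr w) : ∃ k : ℤ, w = shiftPt k z := by
  unfold pr at h
  have h1 := congrArg Prod.fst h
  have h2 := congrArg Prod.snd h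
  simp only at h1 h2
  have h3 : ((w.1 - z.1 : ℝ) : AddCircle (1 : ℝ)) = 0 := by
    rw [AddCircle.coe_sub, h1, sub_self]
  rw [AddCircle.coe_eq_zero_iff] at h3
  obtain ⟨n, hn⟩ := h3
  refine ⟨n, Prod.ext ?_ h2.symm⟩
  simp only [shiftPt]
  simp at hn
  linarith

theorem shift_continuous (k : ℤ) : Continuous (shiftPt k) := by
  unfold shiftPt; fun_prop

theorem shift_shift (k l : ℤ) (z : Strip) : shiftPt k (shiftPt l z) = shiftPt (l + k) z := by
  unfold shiftPt; refine Prod.ext ?_ rfl; simp only; push_cast; ring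

theorem shift_zero (z : Strip) : shiftPt 0 z = z := by
  unfold shiftPt; refine Prod.ext ?_ rfl; simp

theorem shift_dist (k : ℤ) (z w : Strip) : dist (shiftPt k z) (shiftPt k w) = dist z w := by
  simp [shiftPt, Prod.dist_eq]

section EAC
variable {X Um Up : Set Ann}

theorem IsEAC.top (hX : IsEAC X Um Up) {p : Ann} (hp : (p.2 : ℝ) = 1) : p ∈ Up := by
  rw [hX.hUp]
  have hc : IsPreconnected ((univ : Set (AddCircle (1:ℝ))) ×ˢ ({⟨1, by norm_num, le_rfl⟩} : Set II)) :=
    circle_preconnected.isPreconnected_univ.prod isPreconnected_singleton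
  refine hc.subset_connectedComponentIn (by simp) ?_ ?_
  · rintro q ⟨-, hq⟩ hqX
    have := (hX.inInterior q hqX).2
    rw [mem_singleton_iff] at hq
    rw [hq] at this
    simp at this
  · exact ⟨mem_univ _, Subtype.ext hp⟩

theorem IsEAC.bot (hX : IsEAC X Um Up) {p : Ann} (hp : (p.2 : ℝ) = -1) : p ∈ Um := by
  rw [hX.hUm]
  have hc : IsPreconnected ((univ : Set (AddCircle (1:ℝ))) ×ˢ ({⟨-1, le_rfl, by norm_num⟩} : Set II)) :=
    circle_preconnected.isPreconnected_univ.prod isPreconnected_singleton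
  refine hc.subset_connectedComponentIn (by simp) ?_ ?_
  · rintro q ⟨-, hq⟩ hqX
    have := (hX.inInterior q hqX).1
    rw [mem_singleton_iff] at hq
    rw [hq] at this
    simp at this
  · exact ⟨mem_univ _, Subtype.ext hp⟩

theorem IsEAC.disj (hX : IsEAC X Um Up) {p : Ann} (h1 : p ∈ Um) (h2 : p ∈ Up) : False := by
  apply hX.ne
  have e1 := h1
  have e2 := h2
  rw [hX.hUm] at e1
  rw [hX.hUp] at e2
  rw [hX.hUm, hX.hUp, connectedComponentIn_eq e1, connectedComponentIn_eq e2]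

theorem IsEAC.Um_conn (hX : IsEAC X Um Up) : IsPreconnected Um := by
  rw [hX.hUm]; exact isPreconnected_connectedComponentIn
theorem IsEAC.Up_conn (hX : IsEAC X Um Up) : IsPreconnected Up := by
  rw [hX.hUp]; exact isPreconnected_connectedComponentIn

theorem IsEAC.Um_sub (hX : IsEAC X Um Up) : Um ⊆ Xᶜ := by
  rw [hX.cover]; exact subset_union_left
theorem IsEAC.Up_sub (hX : IsEAC X Um Up) : Up ⊆ Xᶜ := by
  rw [hX.cover]; exact subset_union_right

theorem comp_aux {Y : Type*} [TopologicalSpace Y] {S A B : Set Y} {a : Y}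
    (hA : A = connectedComponentIn S a) (ha : a ∈ A) (hAB : S = A ∪ B)
    (hd : ∀ p, p ∈ A → p ∈ B → False) : B = S ∩ (closure A)ᶜ := by
  have hAc : IsPreconnected A := by rw [hA]; exact isPreconnected_connectedComponentIn
  have hAS : A ⊆ S := by rw [hAB]; exact subset_union_left
  have hBS : B ⊆ S := by rw [hAB]; exact subset_union_right
  ext p
  constructor
  · intro hp
    refine ⟨hBS hp, fun hc => ?_⟩
    have h1 : IsPreconnected (insert p A) :=
      hAc.subset_closure (subset_insert _ _) (insert_subset hc subset_closure)
    have h2 : insert p A ⊆ A := by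
      conv_rhs => rw [hA]
      exact h1.subset_connectedComponentIn (mem_insert_of_mem _ ha) (insert_subset (hBS hp) hAS)
    exact hd p (h2 (mem_insert _ _)) hp
  · rintro ⟨h1, h2⟩
    rw [hAB] at h1
    exact h1.resolve_left fun h => h2 (subset_closure h)

theorem IsEAC.Up_eq (hX : IsEAC X Um Up) : Up = Xᶜ ∩ (closure Um)ᶜ :=
  comp_aux hX.hUm (hX.bot rfl) hX.cover (fun _ => hX.disj)

theorem IsEAC.Um_eq (hX : IsEAC X Um Up) : Um = Xᶜ ∩ (closure Up)ᶜ :=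
  comp_aux hX.hUp (hX.top rfl) (by rw [union_comm]; exact hX.cover) (fun _ h h' => hX.disj h' h)

theorem IsEAC.Up_open (hX : IsEAC X Um Up) : IsOpen Up := by
  rw [hX.Up_eq]
  exact hX.compact.isClosed.isOpen_compl.inter isClosed_closure.isOpen_compl

theorem IsEAC.compl (hX : IsEAC X Um Up) : Upᶜ = X ∪ Um := by
  ext p
  have h1 : p ∈ Xᶜ ↔ p ∈ Um ∪ Up := by rw [hX.cover]
  have h2 : ¬ (p ∈ Um ∧ p ∈ Up) := fun h => hX.disj h.1 h.2
  simp only [mem_compl_iff, mem_union] at *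
  tauto

theorem IsEAC.K_conn (hX : IsEAC X Um Up) : IsPreconnected (X ∪ Um) := by
  have hne : (closure Um ∩ X).Nonempty := by
    by_contra hcon
    rw [not_nonempty_iff_eq_empty] at hcon
    have hcl : closure Um ⊆ Um := by
      intro p hp
      by_contra hpU
      have hpX : p ∉ X := fun h => by
        have : p ∈ closure Um ∩ X := ⟨hp, h⟩
        rw [hcon] at this; exact this
      have : p ∈ Up := by
        have h1 : p ∈ Um ∪ Up := by rw [← hX.cover]; exact hpX
        exact h1.resolve_left hpU
      rw [hX.Up_eq] at this
      exact this.2 hp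
    have hclosed : IsClosed Um := isClosed_of_closure_subset hcl
    have hopen : IsOpen Um := by
      rw [hX.Um_eq]
      exact hX.compact.isClosed.isOpen_compl.inter isClosed_closure.isOpen_compl
    have := circle_preconnected
    have := II_preconnected
    have h3 : Um = univ := IsClopen.eq_univ ⟨hclosed, hopen⟩ ⟨_, hX.bot (p := (0, ⟨-1, le_rfl, by norm_num⟩)) rfl⟩
    obtain ⟨x, hx⟩ := hX.connected.nonempty
    exact hX.Um_sub (h3 ▸ mem_univ x) hx
  obtain ⟨q, hq1, hq2⟩ := hne
  have h1 : IsPreconnected (insert q Um) :=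
    hX.Um_conn.subset_closure (subset_insert _ _) (insert_subset hq1 subset_closure)
  have h2 := hX.connected.isPreconnected.union q hq2 (mem_insert _ _) h1
  have : X ∪ insert q Um = X ∪ Um := by
    ext p; simp only [mem_union, mem_insert_iff]
    constructor
    · rintro (h | rfl | h) <;> tauto
    · tauto
  rwa [this] at h2
end EAC

section Fprops
variable {X Um Up : Set Ann} {f : Ann ≃ₜ Ann} {F : Strip ≃ₜ Strip}

theorem F_Xt (hF : IsLift ⇑f ⇑F) (hinv : ⇑f '' X = X) {z : Strip} (hz : z ∈ pr ⁻¹' X) :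
    F z ∈ pr ⁻¹' X := by
  rw [mem_preimage, hF.1, ← hinv]
  exact mem_image_of_mem _ hz

theorem f_Up (hf : IsotopicToId ⇑f) (hX : IsEAC X Um Up) (hinv : ⇑f '' X = X) : ⇑f '' Up = Up := by
  have h1 : ⇑f '' Xᶜ = Xᶜ := by rw [image_compl_eq f.bijective, hinv]
  set p0 : Ann := ((0 : AddCircle (1 : ℝ)), ⟨1, by norm_num, le_rfl⟩) with hp0
  have hp0X : p0 ∈ Xᶜ := hX.Up_sub (hX.top rfl)
  have h2 := f.image_connectedComponentIn hp0X
  rw [h1] at h2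
  have h3 : f p0 ∈ Up := hX.top (iso_top f hf p0 rfl)
  have h4 : Up = connectedComponentIn Xᶜ p0 := hX.hUp
  have h5 : Up = connectedComponentIn Xᶜ (f p0) := by
    rw [h4] at h3 ⊢
    exact connectedComponentIn_eq h3
  conv_lhs => rw [h4]
  rw [h2, ← h5]

theorem F_Ut (hf : IsotopicToId ⇑f) (hF : IsLift ⇑f ⇑F) (hX : IsEAC X Um Up) (hinv : ⇑f '' X = X)
    {z : Strip} (hz : z ∈ pr ⁻¹' Up) : F z ∈ pr ⁻¹' Up := by
  rw [mem_preimage, hF.1, ← f_Up hf hX hinv]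
  exact mem_image_of_mem _ hz

theorem F_top (hf : IsotopicToId ⇑f) (hF : IsLift ⇑f ⇑F) {z : Strip} (hz : (z.2 : ℝ) = 1) :
    ((F z).2 : ℝ) = 1 := by
  have h1 := iso_top f hf (pr z) hz
  rw [← hF.1] at h1
  exact h1

theorem F_mono (hf : IsotopicToId ⇑f) (hF : IsLift ⇑f ⇑F) {z w : Strip} (hz : (z.2 : ℝ) = 1)
    (hw : (w.2 : ℝ) = 1) (h : z.1 < w.1) : (F z).1 < (F w).1 := by
  let g : ℝ → ℝ := fun x => (F (x, ⟨1, by norm_num, le_rfl⟩)).1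
  have hg : Continuous g := by
    have := F.continuous
    fun_prop
  have hinj : Injective g := by
    intro x y hxy
    have h1 : F (x, ⟨1, by norm_num, le_rfl⟩) = F (y, ⟨1, by norm_num, le_rfl⟩) := by
      refine Prod.ext hxy (Subtype.ext ?_)
      rw [F_top hf hF rfl, F_top hf hF rfl]
    exact congrArg Prod.fst (F.injective h1)
  have hm : StrictMono g := by
    rcases hg.strictMono_of_inj hinj with h | h
    · exact h
    · exfalso
      have h1 := h (zero_lt_one)
      have h2 := hF.2 (0, ⟨1, by norm_num, le_rfl⟩)
      have h3 := congrArg Prod.fst h2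
      simp only [shiftPt] at h3
      norm_num at h3
      simp only [g] at h1
      linarith
  have e1 : z = (z.1, ⟨1, by norm_num, le_rfl⟩) := Prod.ext rfl (Subtype.ext hz)
  have e2 : w = (w.1, ⟨1, by norm_num, le_rfl⟩) := Prod.ext rfl (Subtype.ext hw)
  rw [e1, e2]
  exact hm h

theorem F_shift (hF : IsLift ⇑f ⇑F) (k : ℤ) (z : Strip) : F (shiftPt k z) = shiftPt k (F z) := by
  have hnat : ∀ n : ℕ, ∀ z, F (shiftPt n z) = shiftPt n (F z) := by
    intro n
    induction n with
    | zero => intro z; simp [shift_zero]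
    | succ n ih =>
      intro z
      push_cast
      rw [← shift_shift, hF.2, ih, shift_shift]
  obtain ⟨n, rfl | rfl⟩ := Int.eq_nat_or_neg k
  · exact hnat n z
  · have h := hnat n (shiftPt (-n) z)
    rw [shift_shift, neg_add_cancel, shift_zero] at h
    rw [h, shift_shift, add_neg_cancel, shift_zero]
end Fprops

/-- The strip inside the complex plane. -/
noncomputable def io (z : Strip) : ℂ := ⟨z.1, z.2⟩

@[simp] theorem io_re (z : Strip) : (io z).re = z.1 := rfl
@[simp] theorem io_im (z : Strip) : (io z).im = (z.2 : ℝ) := rfl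

theorem io_continuous : Continuous io := by
  have : io = fun z : Strip => (z.1 : ℂ) + ((z.2 : ℝ) : ℂ) * Complex.I := by
    ext z
    apply Complex.ext <;> simp
  rw [this]
  fun_prop

theorem io_inj : Injective io := by
  intro z w h
  have h1 := congrArg Complex.re h
  have h2 := congrArg Complex.im h
  exact Prod.ext h1 (Subtype.ext h2)

theorem io_ne {z w : Strip} (h : z ≠ w) : io z - io w ≠ 0 :=
  sub_ne_zero.2 (fun hh => h (io_inj hh))

theorem dist_le_io (z w : Strip) : dist z w ≤ ‖io z - io w‖ := by
  rw [Prod.dist_eq]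
  refine max_le ?_ ?_
  · have := Complex.abs_re_le_norm (io z - io w)
    simpa [Real.dist_eq] using this
  · have := Complex.abs_im_le_norm (io z - io w)
    rw [Subtype.dist_eq, Real.dist_eq]
    simpa using this

theorem io_le_dist (z w : Strip) : ‖io z - io w‖ ≤ 2 * dist z w := by
  have h1 := Complex.norm_le_abs_re_add_abs_im (io z - io w)
  have h2 : |(io z - io w).re| ≤ dist z w := by
    rw [Prod.dist_eq]
    refine le_trans ?_ (le_max_left _ _)
    simp [Real.dist_eq]
  have h3 : |(io z - io w).im| ≤ dist z w := by
    rw [Prod.dist_eq]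
    refine le_trans ?_ (le_max_right _ _)
    rw [Subtype.dist_eq, Real.dist_eq]
    simp
  linarith

/-- `Λ` is a good branch of the angle of `z - a` on `C`. -/
def GoodBranch (C : Set Strip) (a : Strip) (Λ : Strip → ℝ) : Prop :=
  ContinuousOn Λ C ∧ (∀ z ∈ C, IsAng (io z - io a) (Λ z)) ∧
    ∀ z ∈ C, (z.2 : ℝ) = 1 → Λ z ∈ Ioo 0 Real.pi

theorem good_step {C : Set Strip} {a a' : Strip} {Λ : Strip → ℝ} (h : GoodBranch C a Λ)
    (ha' : (a'.2 : ℝ) < 1)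
    (hd : ∀ z ∈ C, ‖io a' - io a‖ < ‖io z - io a‖) : ∃ Λ', GoodBranch C a' Λ' := by
  obtain ⟨h1, h2, h3⟩ := h
  have hne : ∀ z ∈ C, io z - io a ≠ 0 := fun z hz => by
    rw [← norm_pos_iff]
    exact lt_of_le_of_lt (norm_nonneg _) (hd z hz)
  have hre : ∀ z ∈ C, 0 < ((io z - io a') / (io z - io a)).re := by
    intro z hz
    have e : (io z - io a') / (io z - io a) = 1 - (io a' - io a) / (io z - io a) := by
      field_simp [hne z hz]
      ring
    rw [e]
    have h5 : ‖(io a' - io a) / (io z - io a)‖ < 1 := by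
      rw [norm_div, div_lt_one (norm_pos_iff.2 (hne z hz))]
      exact hd z hz
    have h6 := Complex.re_le_norm ((io a' - io a) / (io z - io a))
    simp only [Complex.sub_re, Complex.one_re]
    linarith
  have hang : ∀ z ∈ C, IsAng (io z - io a')
      (Λ z + Complex.arg ((io z - io a') / (io z - io a))) := by
    intro z hz
    have := (h2 z hz).mul (isAng_arg ((io z - io a') / (io z - io a)))
    rwa [mul_div_cancel₀ _ (hne z hz)] at this
  refine ⟨fun z => Λ z + Complex.arg ((io z - io a') / (io z - io a)), ?_, hang, ?_⟩
  · refine h1.add ?_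
    intro z hz
    have hs : (io z - io a') / (io z - io a) ∈ Complex.slitPlane := Or.inl (hre z hz)
    have hc : ContinuousAt (fun z => (io z - io a') / (io z - io a)) z := by
      refine ContinuousAt.div ?_ ?_ (hne z hz)
      · exact (io_continuous.sub continuous_const).continuousAt
      · exact (io_continuous.sub continuous_const).continuousAt
    exact (ContinuousAt.comp (f := fun z => (io z - io a') / (io z - io a)) (Complex.continuousAt_arg hs) hc).continuousWithinAt
  · intro z hz hz1
    have h4 := h3 z hz hz1
    have h5 := Complex.abs_arg_lt_pi_div_two_iff.2 (Or.inl (hre z hz))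
    rw [abs_lt] at h5
    have h6 := (hang z hz).im
    have him : 0 < (io z - io a').im := by simp [hz1]; exact ha'
    rw [h6] at him
    have hsin : 0 < Real.sin (Λ z + Complex.arg ((io z - io a') / (io z - io a))) := by
      by_contra hcon
      push Not at hcon
      nlinarith [norm_nonneg (io z - io a')]
    set t := Λ z + Complex.arg ((io z - io a') / (io z - io a)) with ht
    have pp := Real.pi_pos
    constructor
    · by_contra hcon
      push Not at hcon
      have := Real.sin_nonpos_of_nonpos_of_neg_pi_le hcon (by linarith [h4.1, h5.1])
      linarith
    · by_contra hcon
      push Not at hcon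
      have := Real.sin_nonpos_of_nonpos_of_neg_pi_le (x := t - 2 * Real.pi) (by linarith [h4.2, h5.2]) (by linarith)
      rw [Real.sin_sub_two_pi] at this
      linarith

theorem good_exists {X Um Up : Set Ann} (hX : IsEAC X Um Up) {C : Set Strip} (hC : IsCompact C)
    (hCU : C ⊆ pr ⁻¹' Up) {a : Strip} (ha : a ∈ pr ⁻¹' X) : ∃ Λ, GoodBranch C a Λ := by
  have hKcl : IsClosed (pr ⁻¹' (X ∪ Um)) := by
    rw [← hX.compl]
    exact (hX.Up_open.isClosed_compl).preimage pr_continuous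
  have hdisj : Disjoint C (pr ⁻¹' (X ∪ Um)) := by
    rw [Set.disjoint_left]
    intro z hz hz'
    rw [← hX.compl] at hz'
    exact hz' (hCU hz)
  obtain ⟨r, hr0, hr⟩ := hdisj.exists_thickenings hC hKcl
  have hfar : ∀ z ∈ C, ∀ b ∈ pr ⁻¹' (X ∪ Um), r ≤ dist z b := by
    intro z hz b hb
    by_contra hcon
    push Not at hcon
    refine Set.disjoint_left.1 hr (Metric.self_subset_thickening hr0 _ hz) ?_
    rw [Metric.mem_thickening_iff]
    exact ⟨b, hb, hcon⟩
  have hlt1 : ∀ b ∈ pr ⁻¹' (X ∪ Um), (b.2 : ℝ) < 1 := by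
    intro b hb
    refine lt_of_le_of_ne b.2.2.2 fun h => ?_
    rw [← hX.compl] at hb
    exact hb (hX.top h)
  have hstep : ∀ b ∈ pr ⁻¹' (X ∪ Um), ∀ b' ∈ pr ⁻¹' (X ∪ Um), dist b' b < r / 2 →
      (∃ Λ, GoodBranch C b Λ) → ∃ Λ, GoodBranch C b' Λ := by
    rintro b hb b' hb' hd ⟨Λ, hΛ⟩
    refine good_step hΛ (hlt1 b' hb') fun z hz => ?_
    have h1 := hfar z hz b hb
    have h2 := dist_le_io z b
    have h3 := io_le_dist b' b
    linarith
  -- projected set of bad points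
  let Z : Set Ann := {q | ∃ b, pr b = q ∧ ¬ ∃ Λ, GoodBranch C b Λ}
  have hloc : ∀ q ∈ X ∪ Um, ∀ᶠ q' in 𝓝[X ∪ Um] q, (q ∈ Z ↔ q' ∈ Z) := by
    intro q hq
    obtain ⟨b0, hb0⟩ := pr_surj q
    have hopen : pr '' Metric.ball b0 (r / 2) ∈ 𝓝 q := by
      rw [← hb0]
      exact (pr_open _ Metric.isOpen_ball).mem_nhds
        (mem_image_of_mem _ (Metric.mem_ball_self (by linarith)))
    filter_upwards [mem_nhdsWithin_of_mem_nhds hopen, self_mem_nhdsWithin] with q' hq' hq'K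
    obtain ⟨b1, hb1, hb1q⟩ := hq'
    rw [Metric.mem_ball] at hb1
    constructor
    · rintro ⟨b, hb, hbad⟩
      obtain ⟨k, rfl⟩ := pr_eq (hb0.trans hb.symm)
      refine ⟨shiftPt k b1, by rw [pr_shift, hb1q], fun hgood => hbad ?_⟩
      refine hstep (shiftPt k b1) ?_ _ ?_ ?_ hgood
      · rw [mem_preimage, pr_shift, hb1q]; exact hq'K
      · rw [mem_preimage, hb]; exact hq
      · rw [shift_dist, dist_comm]; exact hb1
    · rintro ⟨b, hb, hbad⟩
      obtain ⟨k, rfl⟩ := pr_eq (hb1q.trans hb.symm)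
      refine ⟨shiftPt k b0, by rw [pr_shift, hb0], fun hgood => hbad ?_⟩
      refine hstep (shiftPt k b0) ?_ _ ?_ ?_ hgood
      · rw [mem_preimage, pr_shift, hb0]; exact hq
      · rw [mem_preimage, hb]; exact hq'K
      · rw [shift_dist]; exact hb1
  have hiff := hX.K_conn.induction₂ (fun q q' => (q ∈ Z ↔ q' ∈ Z)) hloc
    (fun _ _ _ _ _ _ h h' => h.trans h') (fun _ _ _ _ h => h.symm)
    (x := pr a) (y := (0, ⟨-1, le_rfl, by norm_num⟩)) (Or.inl ha) (Or.inr (hX.bot rfl))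
  by_contra hbad
  obtain ⟨b, hb, hbb⟩ := hiff.1 ⟨a, rfl, hbad⟩
  apply hbb
  have hb2 : (b.2 : ℝ) = -1 := by
    have := congrArg (fun p : Ann => (p.2 : ℝ)) hb
    exact this
  have hpos : ∀ z ∈ C, 0 < (io z - io b).im := by
    intro z hz
    have h1 : -1 < (z.2 : ℝ) := by
      refine lt_of_le_of_ne z.2.2.1 fun h => ?_
      exact hX.disj (hX.bot h.symm) (hCU hz)
    simp [hb2]; linarith
  refine ⟨fun z => Complex.arg (io z - io b), ?_, fun z _ => isAng_arg _, ?_⟩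
  · intro z hz
    have hs : io z - io b ∈ Complex.slitPlane := Or.inr (hpos z hz).ne'
    exact (ContinuousAt.comp (f := fun z => io z - io b) (Complex.continuousAt_arg hs)
      (io_continuous.sub continuous_const).continuousAt).continuousWithinAt
  · intro z hz _
    have h1 := Complex.arg_nonneg_iff.2 (hpos z hz).le
    have h2 := Complex.arg_le_pi (io z - io b)
    refine ⟨lt_of_le_of_ne h1 fun h => ?_, lt_of_le_of_ne h2 fun h => ?_⟩
    · have := (Complex.arg_eq_zero_iff.1 h.symm).2
      linarith [hpos z hz]
    · have := (Complex.arg_eq_pi_iff.1 h).2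
      linarith [hpos z hz]


theorem prec_lift {α β : unitInterval → Strip} (hαc : Continuous α) (hβc : Continuous β)
    (hα0 : ((α 0).2 : ℝ) = 1) (hβ0 : ((β 0).2 : ℝ) = 1) (hlt : (α 0).1 < (β 0).1)
    (hdis : ∀ s t, α s ≠ β t) {τ : unitInterval} {C C' : Set Strip} {Λ Λ' : Strip → ℝ}
    (hΛ : GoodBranch C (α 1) Λ) (hΛ' : GoodBranch C' (β 1) Λ')
    (hC : ∀ t ≤ τ, β t ∈ C) (hC' : ∀ s ≤ τ, α s ∈ C') :
    ∃ θa θb : unitInterval → ℝ, Continuous θa ∧ Continuous θb ∧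
      (∀ t, IsAng (io (β t) - io (α 1)) (θa t)) ∧ (∀ s, IsAng (io (α s) - io (β 1)) (θb s)) ∧
      θa τ = Λ (β τ) ∧ θb τ = Λ' (α τ) ∧ θb 1 = θa 1 + Real.pi := by
  let G : unitInterval × unitInterval → ℂ := fun p => io (β p.2) - io (α p.1)
  have hGc : Continuous G := by
    have := io_continuous
    fun_prop
  have hGne : ∀ p, G p ≠ 0 := fun p => io_ne (hdis p.1 p.2).symm
  have h00 : IsAng (G (0, 0)) 0 := by
    have : G (0, 0) = (((β 0).1 - (α 0).1 : ℝ) : ℂ) := by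
      apply Complex.ext
      · simp [G]
      · simp [G, hα0, hβ0]
    unfold IsAng
    rw [this, Complex.norm_real, Real.norm_of_nonneg (by linarith)]
    simp
  obtain ⟨θ, hθc, hθ0, hθ⟩ := sq_lift G hGc hGne 0 h00
  have hlow : ∀ t, θ (0, t) ∈ Icc (-Real.pi) 0 := by
    intro t
    have := ang_lower (w := fun t : unitInterval => G (0, t)) (θ := fun t => θ (0, t))
      isPreconnected_univ (fun t _ => hGne _) (by fun_prop) (fun t _ => hθ _)
      (fun t _ => by simp [G, hα0]; exact (β t).2.2.2) (mem_univ 0) 0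
      (by simp [hθ0, Real.pi_pos.le]) (mem_univ t)
    simpa using this
  have hup : ∀ s, θ (s, 0) ∈ Icc 0 (Real.pi) := by
    intro s
    have := ang_upper (w := fun s : unitInterval => G (s, 0)) (θ := fun s => θ (s, 0))
      isPreconnected_univ (fun t _ => hGne _) (by fun_prop) (fun t _ => hθ _)
      (fun t _ => by simp [G, hβ0]; exact (α t).2.2.2) (mem_univ 0) 0
      (by simp [hθ0, Real.pi_pos.le]) (mem_univ s)
    simpa using this
  have hτ0 : (0 : unitInterval) ≤ τ := τ.2.1
  refine ⟨fun t => θ (1, t), fun s => θ (s, 1) + Real.pi, by fun_prop, by fun_prop,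
    fun t => hθ (1, t), fun s => ?_, ?_, ?_, rfl⟩
  · have := (hθ (s, 1)).neg
    simp only [G, neg_sub] at this
    exact this
  · have hz : θ (1, 0) = Λ (β 0) :=
      ang_eq_of_Icc (hGne (1, 0)) (hθ (1, 0)) (hΛ.2.1 _ (hC 0 hτ0)) (hup 1)
        (Ioo_subset_Icc_self (hΛ.2.2 _ (hC 0 hτ0) hβ0))
    have := ang_const (S := Icc 0 τ) (w := fun t : unitInterval => G (1, t)) (θ := fun t => θ (1, t))
      (θ' := fun t => Λ (β t)) isPreconnected_Icc (fun t _ => hGne _) (by fun_prop)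
      (hΛ.1.comp hβc.continuousOn (fun t ht => hC t ht.2)) (fun t _ => hθ _)
      (fun t ht => hΛ.2.1 _ (hC t ht.2)) (left_mem_Icc.2 hτ0) (right_mem_Icc.2 hτ0)
    simp only [hz] at this
    linarith
  · have hb : ∀ s, IsAng (io (α s) - io (β 1)) (θ (s, 1) + Real.pi) := by
      intro s
      have := (hθ (s, 1)).neg
      simp only [G, neg_sub] at this
      exact this
    have hz : θ (0, 1) + Real.pi = Λ' (α 0) :=
      ang_eq_of_Icc (io_ne (hdis 0 1)) (hb 0) (hΛ'.2.1 _ (hC' 0 hτ0))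
        ⟨by linarith [(hlow 1).1], by linarith [(hlow 1).2]⟩
        (Ioo_subset_Icc_self (hΛ'.2.2 _ (hC' 0 hτ0) hα0))
    have := ang_const (S := Icc 0 τ) (w := fun s : unitInterval => io (α s) - io (β 1))
      (θ := fun s => θ (s, 1) + Real.pi)
      (θ' := fun s => Λ' (α s)) isPreconnected_Icc (fun t _ => io_ne (hdis _ _)) (by fun_prop)
      (hΛ'.1.comp hαc.continuousOn (fun t ht => hC' t ht.2)) (fun t _ => hb _)
      (fun t ht => hΛ'.2.1 _ (hC' t ht.2)) (left_mem_Icc.2 hτ0) (right_mem_Icc.2 hτ0)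
    simp only [hz] at this
    linarith

/-- an access arc from the top -/
def TAcc (U : Set Strip) (γ : unitInterval → Strip) (a : Strip) : Prop :=
  IsArcTo U γ a ∧ ((γ 0).2 : ℝ) = 1

/-- same germ at the end -/
def Germ (γ γ' : unitInterval → Strip) : Prop := ∃ τ : unitInterval, τ ≠ 1 ∧ ∀ t, τ ≤ t → γ t = γ' t

theorem Germ.symm {γ γ' : unitInterval → Strip} (h : Germ γ γ') : Germ γ' γ := by
  obtain ⟨τ, h1, h2⟩ := h
  exact ⟨τ, h1, fun t ht => (h2 t ht).symm⟩

theorem Germ.trans {γ γ' γ'' : unitInterval → Strip} (h : Germ γ γ') (h' : Germ γ' γ'') :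
    Germ γ γ'' := by
  obtain ⟨τ, h1, h2⟩ := h
  obtain ⟨τ', h1', h2'⟩ := h'
  refine ⟨max τ τ', ?_, fun t ht => ?_⟩
  · rcases max_choice τ τ' with h | h <;> rw [h] <;> assumption
  · rw [h2 t ((le_max_left _ _).trans ht), h2' t ((le_max_right _ _).trans ht)]

theorem Germ.refl (γ : unitInterval → Strip) : Germ γ γ := ⟨0, zero_ne_one, fun _ _ => rfl⟩

theorem Germ.map {γ γ' : unitInterval → Strip} (h : Germ γ γ') (F : Strip → Strip) :
    Germ (fun t => F (γ t)) (fun t => F (γ' t)) := by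
  obtain ⟨τ, h1, h2⟩ := h
  exact ⟨τ, h1, fun t ht => by simp only [h2 t ht]⟩

theorem contra_arcs {X Um Up : Set Ann} (hX : IsEAC X Um Up) {α β α' β' : unitInterval → Strip}
    {a b : Strip} (ha : a ∈ pr ⁻¹' X) (hb : b ∈ pr ⁻¹' X)
    (hα : TAcc (pr ⁻¹' Up) α a) (hβ : TAcc (pr ⁻¹' Up) β b)
    (hα' : TAcc (pr ⁻¹' Up) α' a) (hβ' : TAcc (pr ⁻¹' Up) β' b)
    (hαα : Germ α α') (hββ : Germ β β')
    (hd : ∀ s t, α s ≠ β t) (hd' : ∀ s t, α' s ≠ β' t)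
    (hlt : (α 0).1 < (β 0).1) (hlt' : (β' 0).1 < (α' 0).1) : False := by
  obtain ⟨⟨hαc, -, hαU, rfl⟩, hα0⟩ := hα
  obtain ⟨⟨hβc, -, hβU, rfl⟩, hβ0⟩ := hβ
  obtain ⟨⟨hαc', -, hαU', hα1⟩, hα0'⟩ := hα'
  obtain ⟨⟨hβc', -, hβU', hβ1⟩, hβ0'⟩ := hβ'
  obtain ⟨τ, hτ, hτα, hτβ⟩ : ∃ τ : unitInterval, τ ≠ 1 ∧ (∀ t, τ ≤ t → α t = α' t) ∧
      ∀ t, τ ≤ t → β t = β' t := by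
    obtain ⟨τ, h1, h2⟩ := hαα
    obtain ⟨τ', h1', h2'⟩ := hββ
    refine ⟨max τ τ', ?_, fun t ht => h2 t ((le_max_left _ _).trans ht),
      fun t ht => h2' t ((le_max_right _ _).trans ht)⟩
    rcases max_choice τ τ' with h | h <;> rw [h] <;> assumption
  have hτ1 : τ ≤ 1 := τ.2.2
  have hlt1 : ∀ t ≤ τ, t ≠ 1 := fun t ht h => hτ (le_antisymm hτ1 (h ▸ ht))
  have hcomp : ∀ γ : unitInterval → Strip, Continuous γ → IsCompact (γ '' Icc 0 τ) :=
    fun γ h => isCompact_Icc.image h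
  obtain ⟨Λ, hΛ⟩ := good_exists hX (C := β '' Icc 0 τ ∪ β' '' Icc 0 τ)
    ((hcomp β hβc).union (hcomp β' hβc')) (by
      rintro z (⟨t, ht, rfl⟩ | ⟨t, ht, rfl⟩)
      · exact hβU t (hlt1 t ht.2)
      · exact hβU' t (hlt1 t ht.2)) ha
  obtain ⟨Λ', hΛ'⟩ := good_exists hX (C := α '' Icc 0 τ ∪ α' '' Icc 0 τ)
    ((hcomp α hαc).union (hcomp α' hαc')) (by
      rintro z (⟨t, ht, rfl⟩ | ⟨t, ht, rfl⟩)
      · exact hαU t (hlt1 t ht.2)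
      · exact hαU' t (hlt1 t ht.2)) hb
  obtain ⟨A, B, hAc, hBc, hA, hB, hAτ, hBτ, hAB⟩ := prec_lift hαc hβc hα0 hβ0 hlt hd (τ := τ) hΛ hΛ'
    (fun t ht => Or.inl ⟨t, ⟨t.2.1, ht⟩, rfl⟩) (fun t ht => Or.inl ⟨t, ⟨t.2.1, ht⟩, rfl⟩)
  rw [← hα1] at hΛ
  rw [← hβ1] at hΛ'
  obtain ⟨B', A', hBc', hAc', hB', hA', hBτ', hAτ', hAB'⟩ := prec_lift hβc' hαc' hβ0' hα0' hlt'
    (fun s t => (hd' t s).symm) (τ := τ) hΛ' hΛ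
    (fun t ht => Or.inr ⟨t, ⟨t.2.1, ht⟩, rfl⟩) (fun t ht => Or.inr ⟨t, ⟨t.2.1, ht⟩, rfl⟩)
  rw [hβ1] at hB'
  rw [hα1] at hA'
  have e1 := ang_const (S := Icc τ 1) (w := fun t => io (β t) - io (α 1)) (θ := A) (θ' := A')
    isPreconnected_Icc (fun t _ => io_ne (hd _ _).symm) hAc.continuousOn hAc'.continuousOn
    (fun t _ => hA t) (fun t ht => by simp only [hτβ t ht.1]; exact hA' t)
    (left_mem_Icc.2 hτ1) (right_mem_Icc.2 hτ1)
  have e2 := ang_const (S := Icc τ 1) (w := fun t => io (α t) - io (β 1)) (θ := B) (θ' := B')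
    isPreconnected_Icc (fun t _ => io_ne (hd _ _)) hBc.continuousOn hBc'.continuousOn
    (fun t _ => hB t) (fun t ht => by simp only [hτα t ht.1]; exact hB' t)
    (left_mem_Icc.2 hτ1) (right_mem_Icc.2 hτ1)
  rw [hAτ, hAτ', hτβ τ le_rfl] at e1
  rw [hBτ, hBτ', hτα τ le_rfl] at e2
  have := Real.pi_pos
  linarith

/-- A path in `Ũ₊` from the top on the left of an access arc to the top on its right must meet
the arc. -/
theorem sep {X Um Up : Set Ann} (hX : IsEAC X Um Up) {β σ : unitInterval → Strip} {y : Strip}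
    (hy : y ∈ pr ⁻¹' X) (hβ : TAcc (pr ⁻¹' Up) β y) (hσc : Continuous σ)
    (hσU : ∀ t, σ t ∈ pr ⁻¹' Up) (hσ0 : ((σ 0).2 : ℝ) = 1) (hσ1 : ((σ 1).2 : ℝ) = 1)
    (hl : (σ 0).1 < (β 0).1) (hr : (β 0).1 < (σ 1).1) (hd : ∀ s t, β s ≠ σ t) : False := by
  obtain ⟨⟨hβc, -, hβU, rfl⟩, hβ0⟩ := hβ
  obtain ⟨Λ, hΛ⟩ := good_exists hX (C := range σ) (isCompact_range hσc)
    (by rintro z ⟨t, rfl⟩; exact hσU t) hy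
  let G : unitInterval × unitInterval → ℂ := fun p => io (σ p.2) - io (β p.1)
  have hGc : Continuous G := by
    have := io_continuous
    fun_prop
  have hGne : ∀ p, G p ≠ 0 := fun p => io_ne (hd p.1 p.2).symm
  have h00 : IsAng (G (0, 0)) Real.pi := by
    have : G (0, 0) = (((σ 0).1 - (β 0).1 : ℝ) : ℂ) := by
      apply Complex.ext
      · simp [G]
      · simp [G, hσ0, hβ0]
    unfold IsAng
    rw [this, Complex.norm_real, Real.norm_of_nonpos (by linarith)]
    simp
  have pp := Real.pi_pos
  obtain ⟨θ, hθc, hθ0, hθ⟩ := sq_lift G hGc hGne _ h00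
  have hlow : θ (0, 1) ∈ Icc Real.pi (2 * Real.pi) := by
    have := ang_lower (w := fun t : unitInterval => G (0, t)) (θ := fun t => θ (0, t))
      isPreconnected_univ (fun t _ => hGne _) (by fun_prop) (fun t _ => hθ _)
      (fun t _ => by simp [G, hβ0]; exact (σ t).2.2.2) (mem_univ 0) 1
      (by rw [hθ0]; constructor <;> push_cast <;> linarith) (mem_univ 1)
    constructor <;> [have := this.1; have := this.2] <;> push_cast at this <;> linarith
  have h01 : θ (0, 1) = 2 * Real.pi := by
    have h1 := (hθ (0, 1)).re
    have h2 := (hθ (0, 1)).im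
    have h3 : 0 < (G (0, 1)).re := by simp [G]; exact hr
    have h4 : (G (0, 1)).im = 0 := by simp [G, hσ1, hβ0]
    have h5 : 0 < ‖G (0, 1)‖ := norm_pos_iff.2 (hGne _)
    rw [h4] at h2
    have h6 : Real.sin (θ (0, 1)) = 0 := by
      rcases mul_eq_zero.1 h2.symm with h | h
      · linarith
      · exact h
    by_contra hne
    have h7 : Real.cos (θ (0, 1)) > 0 := by
      by_contra hc
      push Not at hc
      nlinarith
    have h8 : θ (0, 1) < 2 * Real.pi := lt_of_le_of_ne hlow.2 hne
    rcases hlow.1.eq_or_lt with h | h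
    · rw [← h, Real.cos_pi] at h7; linarith
    · have h9 := Real.sin_pos_of_pos_of_lt_pi (x := θ (0, 1) - Real.pi) (by linarith) (by linarith)
      rw [Real.sin_sub_pi] at h9
      linarith
  have hup0 : θ (1, 0) ∈ Icc 0 Real.pi := by
    have := ang_upper (w := fun s : unitInterval => G (s, 0)) (θ := fun s => θ (s, 0))
      isPreconnected_univ (fun t _ => hGne _) (by fun_prop) (fun t _ => hθ _)
      (fun t _ => by simp [G, hσ0]; exact (β t).2.2.2) (mem_univ 0) 0
      (by simp [hθ0, pp.le]) (mem_univ 1)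
    simpa using this
  have hup1 : 2 * Real.pi ≤ θ (1, 1) := by
    have := ang_upper (w := fun s : unitInterval => G (s, 1)) (θ := fun s => θ (s, 1))
      isPreconnected_univ (fun t _ => hGne _) (by fun_prop) (fun t _ => hθ _)
      (fun t _ => by simp [G, hσ1]; exact (β t).2.2.2) (mem_univ 0) 1
      (by simp [h01, pp.le]) (mem_univ 1)
    simpa using this.1
  have hz : θ (1, 0) = Λ (σ 0) :=
    ang_eq_of_Icc (hGne (1, 0)) (hθ (1, 0)) (hΛ.2.1 _ (mem_range_self 0)) hup0
      (Ioo_subset_Icc_self (hΛ.2.2 _ (mem_range_self 0) hσ0))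
  have := ang_const (w := fun t : unitInterval => G (1, t)) (θ := fun t => θ (1, t))
    (θ' := fun t => Λ (σ t)) isPreconnected_univ (fun t _ => hGne _) (by fun_prop)
    (hΛ.1.comp hσc.continuousOn (fun t ht => mem_range_self t)) (fun t _ => hθ _)
    (fun t ht => hΛ.2.1 _ (mem_range_self t)) (mem_univ 0) (mem_univ 1)
  have h3 := hΛ.2.2 _ (mem_range_self 1) hσ1
  simp only [hz] at this
  linarith [h3.2]


theorem concat_raw {Y : Type*} [TopologicalSpace Y] {γ δ : ℝ → Y} {a b c d : ℝ} (hab : a ≤ b)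
    (hcd : c ≤ d)
    (hγ : ContinuousOn γ (Icc a b)) (hγi : InjOn γ (Icc a b))
    (hδ : ContinuousOn δ (Icc c d)) (hδi : InjOn δ (Icc c d)) (hbc : γ b = δ c)
    (hinteg : ∀ s ∈ Icc a b, ∀ t ∈ Icc c d, γ s = δ t → t = c) :
    ∃ h : ℝ → Y, ContinuousOn h (Icc a (b + d - c)) ∧ InjOn h (Icc a (b + d - c)) ∧
      (∀ t, t ≤ b → h t = γ t) ∧ (∀ t, b ≤ t → h t = δ (t - b + c)) := by
  classical
  let h : ℝ → Y := fun t => if t ≤ b then γ t else δ (t - b + c)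
  have h1 : ∀ t, t ≤ b → h t = γ t := fun t ht => by simp [h, ht]
  have h2 : ∀ t, b ≤ t → h t = δ (t - b + c) := by
    intro t ht
    rcases ht.eq_or_lt with rfl | ht
    · rw [h1 b le_rfl, hbc]; simp
    · simp [h, not_le.2 ht]
  refine ⟨h, ?_, ?_, h1, h2⟩
  · have hu : Icc a (b + d - c) = Icc a b ∪ Icc b (b + d - c) :=
      (Icc_union_Icc_eq_Icc hab (by linarith)).symm
    rw [hu]
    refine ContinuousOn.union_of_isClosed ?_ ?_ isClosed_Icc isClosed_Icc
    · exact hγ.congr fun t ht => h1 t ht.2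
    · have : ContinuousOn (fun t => δ (t - b + c)) (Icc b (b + d - c)) := by
        refine hδ.comp (by fun_prop) ?_
        intro t ht
        constructor <;> linarith [ht.1, ht.2]
      exact this.congr fun t ht => h2 t ht.1
  · have key : ∀ s ∈ Icc a (b + d - c), ∀ t ∈ Icc a (b + d - c), s ≤ t → h s = h t → s = t := by
      intro s hs t ht hst e
      rcases le_total t b with htb | htb
      · rw [h1 s (hst.trans htb), h1 t htb] at e
        exact hγi ⟨hs.1, hst.trans htb⟩ ⟨ht.1, htb⟩ e
      · have htm : t - b + c ∈ Icc c d := ⟨by linarith, by linarith [ht.2]⟩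
        rw [h2 t htb] at e
        rcases le_total s b with hsb | hsb
        · rw [h1 s hsb] at e
          have e2 := hinteg s ⟨hs.1, hsb⟩ _ htm e
          have e3 : t = b := by linarith
          rw [e2, ← hbc] at e
          rw [e3]
          exact hγi ⟨hs.1, hsb⟩ ⟨hab, le_rfl⟩ e
        · rw [h2 s hsb] at e
          have := hδi ⟨by linarith, by linarith [hs.2]⟩ htm e
          linarith
    intro s hs t ht e
    rcases le_total s t with h | h
    · exact key s hs t ht h e
    · exact (key t ht s hs h e.symm).symm

/-- `p`, `q` are joined by an arc in `O`. -/
def ArcIn {Y : Type*} [TopologicalSpace Y] (O : Set Y) (p q : Y) : Prop :=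
  ∃ g : ℝ → Y, ContinuousOn g (Icc 0 1) ∧ InjOn g (Icc 0 1) ∧ g 0 = p ∧ g 1 = q ∧
    ∀ t ∈ Icc (0 : ℝ) 1, g t ∈ O

theorem ArcIn.rescale {Y : Type*} [TopologicalSpace Y] {O : Set Y} {p q : Y} (h : ArcIn O p q)
    {a b : ℝ} (hab : a < b) :
    ∃ g : ℝ → Y, ContinuousOn g (Icc a b) ∧ InjOn g (Icc a b) ∧ g a = p ∧ g b = q ∧
    ∀ t ∈ Icc a b, g t ∈ O := by
  obtain ⟨g, h1, h2, h3, h4, h5⟩ := h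
  have hm : ∀ t ∈ Icc a b, (t - a) / (b - a) ∈ Icc (0 : ℝ) 1 := fun t ht =>
    ⟨div_nonneg (by linarith [ht.1]) (by linarith), (div_le_one (by linarith)).2 (by linarith [ht.2])⟩
  refine ⟨fun t => g ((t - a) / (b - a)), h1.comp (by fun_prop) hm, ?_, by simp [h3], ?_,
    fun t ht => h5 _ (hm t ht)⟩
  · intro s hs t ht e
    have := h2 (hm s hs) (hm t ht) e
    have hne : b - a ≠ 0 := by linarith
    field_simp at this
    linarith
  · have hne : b - a ≠ 0 := by linarith
    simp [div_self hne, h4]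

theorem ArcIn.of_Icc {Y : Type*} [TopologicalSpace Y] {O : Set Y} {a b : ℝ} (hab : a < b)
    {g : ℝ → Y} (h1 : ContinuousOn g (Icc a b)) (h2 : InjOn g (Icc a b))
    (h3 : ∀ t ∈ Icc a b, g t ∈ O) : ArcIn O (g a) (g b) := by
  have hm : ∀ t ∈ Icc (0 : ℝ) 1, a + t * (b - a) ∈ Icc a b := fun t ht =>
    ⟨by nlinarith [ht.1], by nlinarith [ht.2]⟩
  refine ⟨fun t => g (a + t * (b - a)), h1.comp (by fun_prop) hm, ?_, by simp, by simp,
    fun t ht => h3 _ (hm t ht)⟩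
  intro s hs t ht e
  have := h2 (hm s hs) (hm t ht) e
  have h : b - a ≠ 0 := by linarith
  have := add_left_cancel this
  exact mul_right_cancel₀ h this

theorem ArcIn.mono {Y : Type*} [TopologicalSpace Y] {O O' : Set Y} {p q : Y} (h : ArcIn O p q)
    (hO : O ⊆ O') : ArcIn O' p q := by
  obtain ⟨g, h1, h2, h3, h4, h5⟩ := h
  exact ⟨g, h1, h2, h3, h4, fun t ht => hO (h5 t ht)⟩

theorem ArcIn.symm {Y : Type*} [TopologicalSpace Y] {O : Set Y} {p q : Y} (h : ArcIn O p q) :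
    ArcIn O q p := by
  obtain ⟨g, h1, h2, h3, h4, h5⟩ := h
  have hm : ∀ t ∈ Icc (0 : ℝ) 1, 1 - t ∈ Icc (0 : ℝ) 1 := fun t ht =>
    ⟨by linarith [ht.2], by linarith [ht.1]⟩
  refine ⟨fun t => g (1 - t), h1.comp (by fun_prop) hm, ?_, by simp [h4], by simp [h3],
    fun t ht => h5 _ (hm t ht)⟩
  intro s hs t ht e
  have := h2 (hm s hs) (hm t ht) e
  linarith

/-- follow `γ` until the last point of `δ` on `γ` -/
theorem last_meet {Y : Type*} [TopologicalSpace Y] [T2Space Y] {γ δ : ℝ → Y} {c : ℝ} (hc : c ≤ 1)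
    (hγ : ContinuousOn γ (Icc 0 1)) (hδ : ContinuousOn δ (Icc c 1)) (h : γ 1 = δ c) :
    ∃ u ∈ Icc (0 : ℝ) 1, ∃ s ∈ Icc c 1, γ u = δ s ∧
      ∀ t ∈ Icc c 1, ∀ v ∈ Icc (0 : ℝ) 1, γ v = δ t → t ≤ s := by
  have hK : IsCompact (γ '' Icc 0 1) := isCompact_Icc.image_of_continuousOn hγ
  have hcl : IsClosed (Icc c 1 ∩ δ ⁻¹' (γ '' Icc 0 1)) :=
    hδ.preimage_isClosed_of_isClosed isClosed_Icc hK.isClosed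
  have hcp : IsCompact (Icc c 1 ∩ δ ⁻¹' (γ '' Icc 0 1)) :=
    isCompact_Icc.of_isClosed_subset hcl inter_subset_left
  obtain ⟨s, ⟨hs1, u, hu, hus⟩, hs⟩ := hcp.exists_isGreatest
    ⟨c, ⟨le_rfl, hc⟩, 1, ⟨zero_le_one, le_rfl⟩, h⟩
  exact ⟨u, hu, s, hs1, hus, fun t ht v hv e => hs ⟨ht, v, hv, e⟩⟩

theorem ArcIn.trans {Y : Type*} [TopologicalSpace Y] [T2Space Y] {O : Set Y} {p q r : Y}
    (h : ArcIn O p q) (h' : ArcIn O q r) : p = r ∨ ArcIn O p r := by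
  by_cases hpr : p = r
  · exact Or.inl hpr
  right
  obtain ⟨γ, h1, h2, rfl, h4, h5⟩ := h
  obtain ⟨δ, h1', h2', h3', rfl, h5'⟩ := h'
  obtain ⟨u, hu, s, hs, hus, hmax⟩ := last_meet zero_le_one h1 h1' (h4.trans h3'.symm)
  obtain ⟨g, g1, g2, g3, g4⟩ := concat_raw hu.1 hs.2 (h1.mono (Icc_subset_Icc_right hu.2))
    (h2.mono (Icc_subset_Icc_right hu.2)) (h1'.mono (Icc_subset_Icc_left hs.1))
    (h2'.mono (Icc_subset_Icc_left hs.1)) hus (fun v hv t ht e =>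
      le_antisymm (hmax t ⟨hs.1.trans ht.1, ht.2⟩ v ⟨hv.1, hv.2.trans hu.2⟩ e) ht.1)
  have e1 : g (u + 1 - s) = δ 1 := by
    rw [g4 _ (by linarith [hs.2])]; congr 1; ring
  have hlt : 0 < u + 1 - s := by
    by_contra hcon
    have hu0 : u = 0 := by linarith [hu.1, hs.2]
    have hs0 : s = 1 := by linarith [hu.1, hs.2]
    apply hpr
    rw [← hu0, hus, hs0]
  have := ArcIn.of_Icc (O := O) hlt g1 g2 (by
    intro t ht
    rcases le_total t u with h | h
    · rw [g3 t h]; exact h5 _ ⟨ht.1, h.trans hu.2⟩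
    · rw [g4 t h]; exact h5' _ ⟨by linarith [hs.1], by linarith [ht.2]⟩)
  rwa [g3 0 hu.1, e1] at this

/-- the straight segment -/
noncomputable def seg (p q : Strip) (t : ℝ) : Strip :=
  (p.1 + t * (q.1 - p.1), projIcc (-1) 1 (by norm_num) ((p.2 : ℝ) + t * (q.2 - p.2)))

theorem seg_snd (p q : Strip) {t : ℝ} (ht : t ∈ Icc (0 : ℝ) 1) :
    ((seg p q t).2 : ℝ) = (p.2 : ℝ) + t * (q.2 - p.2) := by
  have h1 := p.2.2
  have h2 := q.2.2
  have : (p.2 : ℝ) + t * (q.2 - p.2) ∈ Icc (-1 : ℝ) 1 := by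
    constructor
    · nlinarith [h1.1, h2.1, ht.1, ht.2]
    · nlinarith [h1.2, h2.2, ht.1, ht.2]
  unfold seg
  simp only
  rw [projIcc_of_mem _ this]

theorem seg_continuous (p q : Strip) : Continuous (seg p q) := by
  unfold seg
  have : Continuous (projIcc (-1 : ℝ) 1 (by norm_num)) := continuous_projIcc
  fun_prop

theorem seg_zero (p q : Strip) : seg p q 0 = p := by
  refine Prod.ext (by simp [seg]) (Subtype.ext ?_)
  rw [seg_snd _ _ (by simp)]; simp

theorem seg_one (p q : Strip) : seg p q 1 = q := by
  refine Prod.ext (by simp [seg]) (Subtype.ext ?_)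
  rw [seg_snd _ _ (by simp)]; simp

theorem seg_arc {O : Set Strip} {p q : Strip} (hne : p ≠ q)
    (hO : ∀ t ∈ Icc (0 : ℝ) 1, seg p q t ∈ O) : ArcIn O p q := by
  refine ⟨seg p q, (seg_continuous p q).continuousOn, ?_, seg_zero p q, seg_one p q, hO⟩
  intro s hs t ht e
  by_contra hst
  apply hne
  have e1 : p.1 + s * (q.1 - p.1) = p.1 + t * (q.1 - p.1) := congrArg Prod.fst e
  have e2 := congrArg (fun z : Strip => (z.2 : ℝ)) e
  simp only [seg_snd _ _ hs, seg_snd _ _ ht] at e2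
  have hst' : s - t ≠ 0 := sub_ne_zero.2 hst
  have e3 : (s - t) * (q.1 - p.1) = 0 := by linarith
  have e4 : (s - t) * ((q.2 : ℝ) - p.2) = 0 := by linarith
  have e5 := (mul_eq_zero.1 e3).resolve_left hst'
  have e6 := (mul_eq_zero.1 e4).resolve_left hst'
  exact Prod.ext (by linarith) (Subtype.ext (by linarith))

theorem seg_ball {p q : Strip} {r : ℝ} (hq : q ∈ Metric.ball p r) {t : ℝ}
    (ht : t ∈ Icc (0 : ℝ) 1) : seg p q t ∈ Metric.ball p r := by
  rw [Metric.mem_ball] at *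
  refine lt_of_le_of_lt ?_ hq
  rw [Prod.dist_eq, Prod.dist_eq]
  refine max_le_max ?_ ?_
  · rw [Real.dist_eq, Real.dist_eq]
    simp only [seg, add_sub_cancel_left]
    rw [abs_mul, abs_of_nonneg ht.1]
    nlinarith [abs_nonneg (q.1 - p.1), ht.2]
  · rw [Subtype.dist_eq, Subtype.dist_eq, Real.dist_eq, Real.dist_eq, seg_snd _ _ ht]
    simp only [add_sub_cancel_left]
    rw [abs_mul, abs_of_nonneg ht.1]
    nlinarith [abs_nonneg ((q.2 : ℝ) - p.2), ht.2]

theorem ball_preconn (p : Strip) (r : ℝ) : IsPreconnected (Metric.ball p r) := by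
  refine isPreconnected_of_forall p fun q hq => ?_
  refine ⟨seg p q '' Icc 0 1, ?_, ⟨0, by simp, seg_zero p q⟩, ⟨1, by simp, seg_one p q⟩,
    isPreconnected_Icc.image _ (seg_continuous p q).continuousOn⟩
  rintro _ ⟨t, ht, rfl⟩
  exact seg_ball hq ht

theorem arc_conn {O S : Set Strip} (hO : IsOpen O) (hS : IsPreconnected S) (hSO : S ⊆ O)
    {p q : Strip} (hp : p ∈ S) (hq : q ∈ S) : p = q ∨ ArcIn O p q := by
  refine hS.induction₂ (fun p q => p = q ∨ ArcIn O p q) ?_ ?_ ?_ hp hq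
  · intro x hx
    obtain ⟨r, hr, hb⟩ := Metric.isOpen_iff.1 hO x (hSO hx)
    filter_upwards [mem_nhdsWithin_of_mem_nhds (Metric.ball_mem_nhds x hr)] with y hy
    by_cases h : x = y
    · exact Or.inl h
    · exact Or.inr (seg_arc h fun t ht => hb (seg_ball hy ht))
  · rintro x y z - - - (rfl | h1) (rfl | h2)
    · exact Or.inl rfl
    · exact Or.inr h2
    · exact Or.inr h1
    · exact h1.trans h2
  · rintro x y - - (rfl | h)
    · exact Or.inl rfl
    · exact Or.inr h.symm

theorem path_conn {O S : Set Strip} (hO : IsOpen O) (hS : IsPreconnected S) (hSO : S ⊆ O)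
    {p q : Strip} (hp : p ∈ S) (hq : q ∈ S) : JoinedIn O p q := by
  rcases arc_conn hO hS hSO hp hq with rfl | ⟨g, h1, h2, h3, h4, h5⟩
  · exact JoinedIn.refl (hSO hp)
  · refine ⟨⟨⟨fun t => g t, ?_⟩, by simpa using h3, by simpa using h4⟩, fun t => h5 t t.2⟩
    exact h1.comp_continuous continuous_subtype_val (fun t => t.2)

/-- Glue an arc from the top to the final piece of an access arc. -/
theorem glue {U O : Set Strip} (hOU : O ⊆ U) {δ : unitInterval → Strip} {e q : Strip}
    (heU : e ∉ U) (hδ : IsArcTo U δ e) {t0 : unitInterval} (ht0 : t0 ≠ 1)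
    (hδO : ∀ t, t0 ≤ t → t ≠ 1 → δ t ∈ O) (hq : (q.2 : ℝ) = 1) (hqO : q ∈ O)
    (harc : q = δ t0 ∨ ArcIn O q (δ t0)) :
    ∃ ε, TAcc U ε e ∧ ε 0 = q ∧ Germ ε δ ∧ ∀ t, t ≠ 1 → ε t ∈ O := by
  classical
  obtain ⟨hδc, hδi, hδU, hδ1⟩ := hδ
  have ht01 : (t0 : ℝ) < 1 := lt_of_le_of_ne t0.2.2 (fun h => ht0 (Subtype.ext h))
  have ht00 : (0 : ℝ) ≤ t0 := t0.2.1
  let d : ℝ → Strip := fun t => δ (projIcc 0 1 zero_le_one t)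
  have hdc : Continuous d := hδc.comp continuous_projIcc
  have hde : ∀ t : unitInterval, d t = δ t := fun t => by simp [d, projIcc_val]
  have hdi : InjOn d (Icc 0 1) := by
    intro s hs t ht e
    have := hδi e
    rw [projIcc_of_mem _ hs, projIcc_of_mem _ ht] at this
    exact congrArg Subtype.val this
  have hdO : ∀ t ∈ Ico (t0 : ℝ) 1, d t ∈ O := by
    intro t ht
    have h : t ∈ Icc (0 : ℝ) 1 := ⟨ht00.trans ht.1, ht.2.le⟩
    have := hδO ⟨t, h⟩ ht.1 (fun h' => ht.2.ne (congrArg Subtype.val h'))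
    rwa [← hde] at this
  have hd1 : d 1 = e := by rw [← hδ1]; exact hde 1
  -- an arc `κ` from `q` to `d τ`
  obtain ⟨τ, hτ, κ, k1, k2, k3, k4, k5, k6⟩ : ∃ τ ∈ Ico (t0 : ℝ) 1, ∃ κ : ℝ → Strip,
      ContinuousOn κ (Icc 0 τ) ∧ InjOn κ (Icc 0 τ) ∧ κ 0 = q ∧ κ τ = d τ ∧
      (∀ t ∈ Icc 0 τ, κ t ∈ O) ∧ ∀ s ∈ Icc 0 τ, ∀ t ∈ Icc τ 1, κ s = d t → t = τ := by
    suffices h : ∃ τ ∈ Ioo (t0 : ℝ) 1, ∃ O' ⊆ O, ArcIn O' q (d τ) ∧ ∀ t ∈ Icc τ 1, d t ∈ O' → t = τ by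
      obtain ⟨τ, hτ, O', hO', ha, hb⟩ := h
      obtain ⟨κ, k1, k2, k3, k4, k5⟩ := ha.rescale (a := 0) (b := τ) (by linarith [hτ.1])
      exact ⟨τ, ⟨hτ.1.le, hτ.2⟩, κ, k1, k2, k3, k4, fun t ht => hO' (k5 t ht), fun s hs t ht e =>
        hb t ht (e ▸ k5 s hs)⟩
    rcases harc with h | ⟨γ, g1, g2, g3, g4, g5⟩
    · refine ⟨(t0 + 1) / 2, ⟨by linarith, by linarith⟩, d '' Icc t0 ((t0 + 1) / 2), ?_, ?_, ?_⟩
      · rintro _ ⟨t, ht, rfl⟩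
        exact hdO t ⟨ht.1, by linarith [ht.2]⟩
      · have := ArcIn.of_Icc (O := d '' Icc t0 ((t0 + 1) / 2)) (a := t0) (b := (t0 + 1) / 2)
          (by linarith) hdc.continuousOn (hdi.mono (Icc_subset_Icc ht00 (by linarith)))
          (fun t ht => mem_image_of_mem _ ht)
        rwa [hde, ← h] at this
      · rintro t ht ⟨s, hs, e⟩
        have := hdi ⟨by linarith [hs.1], by linarith [hs.2]⟩ ⟨by linarith [ht.1], ht.2⟩ e
        linarith [hs.2, ht.1]
    · obtain ⟨u, hu, s, hs, hus, hmax⟩ := last_meet ht01.le g1 hdc.continuousOn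
        (by rw [g4, hde])
      have hs1 : s < 1 := by
        refine lt_of_le_of_ne hs.2 fun h => heU ?_
        rw [← hd1, ← h, ← hus]
        exact hOU (g5 u hu)
      set τ := (s + 1) / 2 with hτ
      have hsτ : s < τ := by rw [hτ]; linarith
      have hτ1 : τ < 1 := by rw [hτ]; linarith
      have hs0 : 0 ≤ s := ht00.trans hs.1
      obtain ⟨g, c1, c2, c3, c4⟩ := concat_raw (d := τ) hu.1 hsτ.le (g1.mono (Icc_subset_Icc_right hu.2))
        (g2.mono (Icc_subset_Icc_right hu.2)) hdc.continuousOn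
        (hdi.mono (Icc_subset_Icc hs0 hτ1.le)) hus (fun v hv t ht e =>
          le_antisymm (hmax t ⟨hs.1.trans ht.1, ht.2.trans hτ1.le⟩ v ⟨hv.1, hv.2.trans hu.2⟩ e) ht.1)
      refine ⟨τ, ⟨hs.1.trans_lt hsτ, hτ1⟩, γ '' Icc 0 u ∪ d '' Icc s τ, ?_, ?_, ?_⟩
      · rintro _ (⟨t, ht, rfl⟩ | ⟨t, ht, rfl⟩)
        · exact g5 t ⟨ht.1, ht.2.trans hu.2⟩
        · exact hdO t ⟨hs.1.trans ht.1, ht.2.trans_lt hτ1⟩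
      · have := ArcIn.of_Icc (O := γ '' Icc 0 u ∪ d '' Icc s τ) (a := 0) (b := u + τ - s)
          (by linarith [hu.1]) c1 c2 (by
            intro t ht
            rcases le_total t u with h | h
            · rw [c3 t h]; exact Or.inl ⟨t, ⟨ht.1, h⟩, rfl⟩
            · rw [c4 t h]; exact Or.inr ⟨_, ⟨by linarith, by linarith [ht.2]⟩, rfl⟩)
        rw [c3 0 hu.1, g3, c4 _ (by linarith)] at this
        convert this using 2
        ring
      · rintro t ht (⟨v, hv, e⟩ | ⟨v, hv, e⟩)
        · have := hmax t ⟨by linarith [ht.1, hs.1], ht.2⟩ v ⟨hv.1, hv.2.trans hu.2⟩ e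
          linarith [ht.1]
        · have := hdi ⟨by linarith [hv.1], by linarith [hv.2]⟩ ⟨by linarith [ht.1], ht.2⟩ e
          linarith [hv.2, ht.1]
  have hτ0 : 0 ≤ τ := ht00.trans hτ.1
  obtain ⟨g, c1, c2, c3, c4⟩ := concat_raw (d := 1) hτ0 hτ.2.le k1 k2 hdc.continuousOn
    (hdi.mono (Icc_subset_Icc_left hτ0)) k4 k6
  have e1 : τ + 1 - τ = 1 := by ring
  rw [e1] at c1 c2
  have c4' : ∀ t, τ ≤ t → g t = d t := fun t ht => by rw [c4 t ht]; congr 1; ring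
  have hO : ∀ t : unitInterval, t ≠ 1 → g t ∈ O := by
    intro t ht
    rcases le_total (t : ℝ) τ with h | h
    · rw [c3 t h]; exact k5 t ⟨t.2.1, h⟩
    · rw [c4' t h]
      exact hdO t ⟨hτ.1.trans h, lt_of_le_of_ne t.2.2 (fun h => ht (Subtype.ext h))⟩
  have hg0 : g 0 = q := by rw [c3 0 hτ0, k3]
  refine ⟨fun t => g t, ⟨⟨c1.comp_continuous continuous_subtype_val fun t => t.2, ?_,
    fun t ht => hOU (hO t ht), ?_⟩, ?_⟩, ?_, ?_, hO⟩
  · intro s t e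
    exact Subtype.ext (c2 s.2 t.2 e)
  · show g ((1 : unitInterval) : ℝ) = e
    rw [c4' _ (by simpa using hτ.2.le)]
    simpa using hd1
  · show ((g ((0 : unitInterval) : ℝ)).2 : ℝ) = 1
    simpa [hg0] using hq
  · simpa using hg0
  · exact ⟨⟨τ, hτ0, hτ.2.le⟩, fun h => hτ.2.ne (congrArg Subtype.val h), fun t ht => by
      show g t = δ t
      rw [c4' t ht, hde]⟩


noncomputable section Regions

/-- the open vertical line above `(m, η)` -/
def LL (η : ℝ) (m : ℤ) : Set Strip := {z : Strip | z.1 = (m : ℝ) ∧ η < (z.2 : ℝ)}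

def ept (η : ℝ) (m : ℤ) : Strip := ((m : ℝ), projIcc (-1) 1 (by norm_num) η)

def bl (η : ℝ) (m : ℤ) (t : unitInterval) : Strip :=
  ((m : ℝ), projIcc (-1) 1 (by norm_num) (1 - (t : ℝ) * (1 - η)))

def tpt (x : ℝ) : Strip := (x, ⟨1, by norm_num, le_rfl⟩)

def tp (j : ℤ) : Strip := tpt (j + 1 / 2)

def CC (U : Set Strip) (η : ℝ) (j : ℤ) : Set Strip :=
  connectedComponentIn (U \ (LL η j ∪ LL η (j + 1))) (tp j)

def DD (η : ℝ) : Set Strip := ⋃ m : ℤ, LL η m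

theorem comp_open {O : Set Strip} (hO : IsOpen O) (x : Strip) : IsOpen (connectedComponentIn O x) := by
  rw [Metric.isOpen_iff]
  intro y hy
  obtain ⟨r, hr, hb⟩ := Metric.isOpen_iff.1 hO y (connectedComponentIn_subset _ _ hy)
  refine ⟨r, hr, ?_⟩
  rw [connectedComponentIn_eq hy]
  exact (ball_preconn y r).subset_connectedComponentIn (Metric.mem_ball_self hr) hb

theorem LL_preconn (η : ℝ) (m : ℤ) : IsPreconnected (LL η m) := by
  have : LL η m = ({(m : ℝ)} : Set ℝ) ×ˢ {y : II | η < (y : ℝ)} := by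
    ext z; simp [LL]
  rw [this]
  refine isPreconnected_singleton.prod ?_
  rw [← IsInducing.subtypeVal.isPreconnected_image]
  have : (Subtype.val '' {y : II | η < (y : ℝ)}) = Ioi η ∩ Icc (-1) 1 := by
    ext y; simp [and_comm]
  rw [this]
  exact (ordConnected_Ioi.inter ordConnected_Icc).isPreconnected

variable {X Um Up : Set Ann} {η : ℝ}

theorem le_eta (hη : etaSpec (pr ⁻¹' X) η) {w : Strip} (hw : w ∈ pr ⁻¹' X) {m : ℤ}
    (h : w.1 = (m : ℝ)) : (w.2 : ℝ) ≤ η := by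
  refine hη.2 ⟨shiftPt (-m) w, ?_, ?_, rfl⟩
  · rw [mem_preimage, pr_shift]; exact hw
  · simp [shiftPt, h]

theorem eta_mem (hX : IsEAC X Um Up) (hη : etaSpec (pr ⁻¹' X) η) : η ∈ Ioo (-1 : ℝ) 1 := by
  obtain ⟨z, hz, h0, rfl⟩ := hη.1
  exact hX.inInterior _ hz

theorem ept_mem (hX : IsEAC X Um Up) (hη : etaSpec (pr ⁻¹' X) η) (m : ℤ) :
    ept η m ∈ pr ⁻¹' X := by
  have hm := eta_mem hX hη
  obtain ⟨z, hz, h0, h1⟩ := hη.1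
  have : ept η m = shiftPt m z := by
    refine Prod.ext (by simp [ept, shiftPt, h0]) (Subtype.ext ?_)
    simp only [ept, shiftPt]
    rw [projIcc_of_mem _ ⟨hm.1.le, hm.2.le⟩, h1]
  rw [this, mem_preimage, pr_shift]; exact hz

theorem up_of_conn (hX : IsEAC X Um Up) {S : Set Strip} (hS : IsPreconnected S)
    (hSX : ∀ z ∈ S, z ∉ pr ⁻¹' X) {p : Strip} (hp : p ∈ S) (hpU : p ∈ pr ⁻¹' Up) :
    S ⊆ pr ⁻¹' Up := by
  have h1 : pr p ∈ connectedComponentIn Xᶜ ((0 : AddCircle (1 : ℝ)), ⟨1, by norm_num, le_rfl⟩) := by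
    rw [← hX.hUp]; exact hpU
  have h2 := connectedComponentIn_eq h1
  rw [← hX.hUp] at h2
  have h3 := (hS.image pr pr_continuous.continuousOn).subset_connectedComponentIn (F := Xᶜ)
    (mem_image_of_mem _ hp) (by rintro _ ⟨z, hz, rfl⟩; exact hSX z hz)
  rw [← h2] at h3
  exact image_subset_iff.1 h3

theorem top_U (hX : IsEAC X Um Up) {p : Strip} (hp : (p.2 : ℝ) = 1) : p ∈ pr ⁻¹' Up :=
  hX.top (p := pr p) hp

theorem LL_sub (hX : IsEAC X Um Up) (hη : etaSpec (pr ⁻¹' X) η) (m : ℤ) :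
    LL η m ⊆ pr ⁻¹' Up :=
  up_of_conn hX (LL_preconn η m) (fun z hz hzX => by
    have := le_eta hη hzX hz.1
    linarith [hz.2]) (p := tpt m) ⟨rfl, (eta_mem hX hη).2⟩ (top_U hX rfl)

theorem X_not_U (hX : IsEAC X Um Up) {z : Strip} (hz : z ∈ pr ⁻¹' X) : z ∉ pr ⁻¹' Up :=
  fun h => hX.Up_sub h hz

theorem bl_snd (hX : IsEAC X Um Up) (hη : etaSpec (pr ⁻¹' X) η) (m : ℤ) (t : unitInterval) :
    ((bl η m t).2 : ℝ) = 1 - (t : ℝ) * (1 - η) := by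
  have hm := eta_mem hX hη
  have h0 := t.2.1
  have h1 := t.2.2
  simp only [bl]
  rw [projIcc_of_mem]
  constructor <;> nlinarith [hm.1, hm.2]

theorem bl_mem (hX : IsEAC X Um Up) (hη : etaSpec (pr ⁻¹' X) η) (m : ℤ) {t : unitInterval}
    (ht : t ≠ 1) : bl η m t ∈ LL η m := by
  have hm := eta_mem hX hη
  have h1 : (t : ℝ) < 1 := lt_of_le_of_ne t.2.2 (fun h => ht (Subtype.ext h))
  refine ⟨rfl, ?_⟩
  rw [bl_snd hX hη]
  nlinarith [hm.2]

theorem bl_acc (hX : IsEAC X Um Up) (hη : etaSpec (pr ⁻¹' X) η) (m : ℤ) :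
    TAcc (pr ⁻¹' Up) (bl η m) (ept η m) := by
  have hm := eta_mem hX hη
  refine ⟨⟨?_, ?_, fun t ht => LL_sub hX hη m (bl_mem hX hη m ht), ?_⟩, ?_⟩
  · unfold bl
    have : Continuous (projIcc (-1 : ℝ) 1 (by norm_num)) := continuous_projIcc
    fun_prop
  · intro s t e
    have := congrArg (fun z : Strip => (z.2 : ℝ)) e
    simp only [bl_snd hX hη] at this
    have h : (1 : ℝ) - η ≠ 0 := by linarith [hm.2]
    exact Subtype.ext (mul_right_cancel₀ h (by linarith))
  · simp [bl, ept]
  · rw [bl_snd hX hη]; simp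

theorem U_open (hX : IsEAC X Um Up) : IsOpen (pr ⁻¹' Up) := hX.Up_open.preimage pr_continuous

theorem U_LL_open (hX : IsEAC X Um Up) (hη : etaSpec (pr ⁻¹' X) η) (m : ℤ) :
    IsOpen (pr ⁻¹' Up \ LL η m) := by
  have : pr ⁻¹' Up \ LL η m = pr ⁻¹' Up ∩ {z : Strip | z.1 = (m : ℝ) ∧ η ≤ (z.2 : ℝ)}ᶜ := by
    ext z
    constructor
    · rintro ⟨h1, h2⟩
      refine ⟨h1, fun h3 => h2 ⟨h3.1, lt_of_le_of_ne h3.2 fun h4 => ?_⟩⟩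
      refine X_not_U hX (ept_mem hX hη m) ?_
      convert h1
      refine Prod.ext h3.1.symm (Subtype.ext ?_)
      have hm := eta_mem hX hη
      simp only [ept]
      rw [projIcc_of_mem _ ⟨hm.1.le, hm.2.le⟩]; exact h4
    · rintro ⟨h1, h2⟩
      exact ⟨h1, fun h3 => h2 ⟨h3.1, h3.2.le⟩⟩
  rw [this]
  refine (U_open hX).inter (IsClosed.isOpen_compl (self := ?_))
  have h1 : IsClosed {z : Strip | z.1 = (m : ℝ)} := isClosed_eq (by fun_prop) (by fun_prop)
  have h2 : IsClosed {z : Strip | η ≤ (z.2 : ℝ)} := isClosed_le (by fun_prop) (by fun_prop)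
  exact h1.inter h2

theorem U_DD_open (hX : IsEAC X Um Up) (hη : etaSpec (pr ⁻¹' X) η) :
    IsOpen (pr ⁻¹' Up \ DD η) := by
  have : pr ⁻¹' Up \ DD η = pr ⁻¹' Up ∩
      ((Prod.fst : Strip → ℝ) ⁻¹' (range ((↑) : ℤ → ℝ)) ∩ {z : Strip | η ≤ (z.2 : ℝ)})ᶜ := by
    ext z
    constructor
    · rintro ⟨h1, h2⟩
      refine ⟨h1, ?_⟩
      rintro ⟨⟨m, h3⟩, h3'⟩
      refine h2 (mem_iUnion.2 ⟨m, h3.symm, lt_of_le_of_ne h3' fun h4 => ?_⟩)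
      refine X_not_U hX (ept_mem hX hη m) ?_
      convert h1
      refine Prod.ext h3 (Subtype.ext ?_)
      have hm := eta_mem hX hη
      simp only [ept]
      rw [projIcc_of_mem _ ⟨hm.1.le, hm.2.le⟩]; exact h4
    · rintro ⟨h1, h2⟩
      refine ⟨h1, fun h3 => h2 ?_⟩
      obtain ⟨m, h3⟩ := mem_iUnion.1 h3
      exact ⟨⟨m, h3.1.symm⟩, h3.2.le⟩
  rw [this]
  refine (U_open hX).inter (IsClosed.isOpen_compl (self := ?_))
  exact (Int.isClosedEmbedding_coe_real.isClosed_range.preimage continuous_fst).inter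
    (isClosed_le (by fun_prop) (by fun_prop))

theorem U2_open (hX : IsEAC X Um Up) (hη : etaSpec (pr ⁻¹' X) η) (j : ℤ) :
    IsOpen (pr ⁻¹' Up \ (LL η j ∪ LL η (j + 1))) := by
  rw [← sdiff_inter_sdiff]
  exact (U_LL_open hX hη j).inter (U_LL_open hX hη (j + 1))

theorem CC_open (hX : IsEAC X Um Up) (hη : etaSpec (pr ⁻¹' X) η) (j : ℤ) :
    IsOpen (CC (pr ⁻¹' Up) η j) := comp_open (U2_open hX hη j) _

theorem tp_not_LL (j m : ℤ) : tp j ∉ LL η m := by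
  rintro ⟨h, -⟩
  simp only [tp, tpt] at h
  have h2 : (2 * (j : ℝ) + 1) = 2 * m := by linarith
  have h3 : 2 * j + 1 = 2 * m := by exact_mod_cast h2
  omega

theorem tp_mem (hX : IsEAC X Um Up) (j : ℤ) : tp j ∈ pr ⁻¹' Up \ (LL η j ∪ LL η (j + 1)) :=
  ⟨top_U hX rfl, by rintro (h | h) <;> exact tp_not_LL _ _ h⟩

theorem tp_CC (hX : IsEAC X Um Up) (j : ℤ) : tp j ∈ CC (pr ⁻¹' Up) η j :=
  mem_connectedComponentIn (tp_mem hX j)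

theorem CC_sub (j : ℤ) : CC (pr ⁻¹' Up) η j ⊆ pr ⁻¹' Up \ (LL η j ∪ LL η (j + 1)) :=
  connectedComponentIn_subset _ _

theorem CC_preconn (j : ℤ) : IsPreconnected (CC (pr ⁻¹' Up) η j) :=
  isPreconnected_connectedComponentIn

/-- no crossing of a line -/
theorem nosep (hX : IsEAC X Um Up) (hη : etaSpec (pr ⁻¹' X) η) {m : ℤ} {p q : Strip}
    (h : JoinedIn (pr ⁻¹' Up \ LL η m) p q) (hp : (p.2 : ℝ) = 1) (hq : (q.2 : ℝ) = 1)
    (hpm : p.1 < m) (hqm : m < q.1) : False := by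
  obtain ⟨σ, hσ⟩ := h
  refine sep hX (ept_mem hX hη m) (bl_acc hX hη m) (σ := σ) σ.continuous (fun t => (hσ t).1)
    (by simpa using hp) (by simpa using hq) (by simpa [bl] using hpm) (by simpa [bl] using hqm) ?_
  intro s t e
  by_cases hs : s = 1
  · rw [hs, (bl_acc hX hη m).1.2.2.2] at e
    exact X_not_U hX (ept_mem hX hη m) (e ▸ (hσ t).1)
  · exact (hσ t).2 (e ▸ bl_mem hX hη m hs)

theorem LL_disj {m m' : ℤ} (h : m ≠ m') {z : Strip} (hz : z ∈ LL η m) : z ∉ LL η m' := by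
  intro hz'
  have := hz.1.symm.trans hz'.1
  exact h (by exact_mod_cast this)

theorem CC_avoid (hX : IsEAC X Um Up) (hη : etaSpec (pr ⁻¹' X) η) {j m : ℤ} {z : Strip}
    (hz : z ∈ CC (pr ⁻¹' Up) η j) : z ∉ LL η m := by
  intro hzm
  have hzs := (CC_sub j hz).2
  have h1 : m ≠ j := by rintro rfl; exact hzs (Or.inl hzm)
  have h2 : m ≠ j + 1 := by rintro rfl; exact hzs (Or.inr hzm)
  have hpc : IsPreconnected (CC (pr ⁻¹' Up) η j ∪ LL η m) :=
    IsPreconnected.union z hz hzm (CC_preconn j) (LL_preconn η m)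
  have hsub : CC (pr ⁻¹' Up) η j ∪ LL η m ⊆ pr ⁻¹' Up \ (LL η j ∪ LL η (j + 1)) := by
    rintro w (hw | hw)
    · exact CC_sub j hw
    · exact ⟨LL_sub hX hη m hw, by
        rintro (h | h)
        · exact LL_disj h1 hw h
        · exact LL_disj h2 hw h⟩
  have hJ := path_conn (U2_open hX hη j) hpc hsub (p := tp j) (q := tpt m)
    (Or.inl (tp_CC hX j)) (Or.inr ⟨rfl, (eta_mem hX hη).2⟩)
  rcases lt_or_gt_of_ne h1 with h | h
  · have hmj : (m : ℝ) < j := by exact_mod_cast h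
    exact nosep hX hη (hJ.symm.mono (sdiff_subset_sdiff_right subset_union_left)) rfl rfl
      (by simpa [tpt] using hmj) (by simp [tp, tpt])
  · have hmj : ((j + 1 : ℤ) : ℝ) < m := by exact_mod_cast (by omega : j + 1 < m)
    exact nosep hX hη (m := j + 1) (hJ.mono (sdiff_subset_sdiff_right subset_union_right)) rfl rfl
      (by simp [tp, tpt]; norm_num) (by simpa [tpt] using hmj)

theorem CC_DD (hX : IsEAC X Um Up) (hη : etaSpec (pr ⁻¹' X) η) (j : ℤ) :
    CC (pr ⁻¹' Up) η j ⊆ pr ⁻¹' Up \ DD η := fun z hz =>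
  ⟨(CC_sub j hz).1, fun h => by
    obtain ⟨m, h⟩ := mem_iUnion.1 h
    exact CC_avoid hX hη hz h⟩

theorem shift_U {k : ℤ} {z : Strip} : shiftPt k z ∈ pr ⁻¹' Up ↔ z ∈ pr ⁻¹' Up := by
  rw [mem_preimage, mem_preimage, pr_shift]

theorem shift_LL {k m : ℤ} {z : Strip} : shiftPt k z ∈ LL η (m + k) ↔ z ∈ LL η m := by
  simp [LL, shiftPt]

theorem shift_CC (hX : IsEAC X Um Up) {j : ℤ} (k : ℤ) {z : Strip} (hz : z ∈ CC (pr ⁻¹' Up) η j) :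
    shiftPt k z ∈ CC (pr ⁻¹' Up) η (j + k) := by
  have h1 : IsPreconnected (shiftPt k '' CC (pr ⁻¹' Up) η j) :=
    (CC_preconn j).image _ (shift_continuous k).continuousOn
  have h2 : tp (j + k) ∈ shiftPt k '' CC (pr ⁻¹' Up) η j := by
    refine ⟨tp j, tp_CC hX j, Prod.ext ?_ rfl⟩
    simp [tp, tpt, shiftPt]; ring
  refine h1.subset_connectedComponentIn h2 ?_ (mem_image_of_mem _ hz)
  rintro _ ⟨w, hw, rfl⟩
  have hw := CC_sub j hw
  refine ⟨shift_U.2 hw.1, ?_⟩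
  rintro (h | h)
  · exact hw.2 (Or.inl (shift_LL.1 h))
  · rw [show j + k + 1 = j + 1 + k by ring] at h
    exact hw.2 (Or.inr (shift_LL.1 h))

theorem shift_Vset (hX : IsEAC X Um Up) (j : ℤ) :
    shiftSet j (Vset (pr ⁻¹' Up) η) = pr ⁻¹' Up ∩ closure (CC (pr ⁻¹' Up) η j) := by
  have hV : Vset (pr ⁻¹' Up) η = pr ⁻¹' Up ∩ closure (CC (pr ⁻¹' Up) η 0) := by
    unfold Vset CC
    congr 3
    · congr 2
      · ext z; simp [betaP, LL]
      · ext z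
        simp only [shiftSet, mem_image, betaP, LL, shiftPt, mem_ofPred_eq]
        constructor
        · rintro ⟨w, ⟨h1, h2⟩, rfl⟩
          simp [h1, h2]
        · rintro ⟨h1, h2⟩
          exact ⟨(0, z.2), ⟨rfl, h2⟩, Prod.ext (by simp [h1]) rfl⟩
    · simp [topSeg, tp, tpt]
  have key : ∀ (j k : ℤ) (z : Strip), z ∈ pr ⁻¹' Up ∩ closure (CC (pr ⁻¹' Up) η j) →
      shiftPt k z ∈ pr ⁻¹' Up ∩ closure (CC (pr ⁻¹' Up) η (j + k)) := by
    rintro j k z ⟨h1, h2⟩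
    refine ⟨shift_U.2 h1, ?_⟩
    refine closure_mono ?_ (image_closure_subset_closure_image (shift_continuous k)
      (mem_image_of_mem _ h2))
    rintro _ ⟨w, hw, rfl⟩
    exact shift_CC hX k hw
  rw [hV]
  ext z
  constructor
  · rintro ⟨w, hw, rfl⟩
    have := key 0 j w hw
    rwa [zero_add] at this
  · intro hz
    refine ⟨shiftPt (-j) z, ?_, ?_⟩
    · have := key j (-j) z hz
      rwa [add_neg_cancel] at this
    · rw [shift_shift]; simp [shift_zero]

theorem tops_preconn (j : ℤ) : IsPreconnected (tpt '' Ioo (j : ℝ) (j + 1)) := by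
  refine isPreconnected_Ioo.image _ (Continuous.continuousOn ?_)
  unfold tpt; fun_prop

theorem strip_rect_preconn (a b y0 : ℝ) :
    IsPreconnected {z : Strip | z.1 ∈ Ioo a b ∧ y0 < (z.2 : ℝ)} := by
  have : {z : Strip | z.1 ∈ Ioo a b ∧ y0 < (z.2 : ℝ)} = (Ioo a b) ×ˢ {y : II | y0 < (y : ℝ)} := by
    ext z; simp
  rw [this]
  refine isPreconnected_Ioo.prod ?_
  rw [← IsInducing.subtypeVal.isPreconnected_image]
  have : (Subtype.val '' {y : II | y0 < (y : ℝ)}) = Ioi y0 ∩ Icc (-1) 1 := by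
    ext y; simp [and_comm]
  rw [this]
  exact (ordConnected_Ioi.inter ordConnected_Icc).isPreconnected

theorem rect_CC (hX : IsEAC X Um Up) {j : ℤ} {a b y0 : ℝ} (ha : (j : ℝ) ≤ a)
    (hab : a < b) (hb : b ≤ j + 1) (hy : y0 < 1)
    (hsub : ∀ z : Strip, z.1 ∈ Ioo a b → y0 < (z.2 : ℝ) → z ∈ pr ⁻¹' Up) {z : Strip}
    (h1 : z.1 ∈ Ioo a b) (h2 : y0 < (z.2 : ℝ)) : z ∈ CC (pr ⁻¹' Up) η j := by
  have hc : IsPreconnected ({z : Strip | z.1 ∈ Ioo a b ∧ y0 < (z.2 : ℝ)} ∪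
      tpt '' Ioo (j : ℝ) (j + 1)) := by
    refine IsPreconnected.union (tpt ((a + b) / 2)) ⟨⟨?_, ?_⟩, hy⟩
      ⟨_, ⟨?_, ?_⟩, rfl⟩ (strip_rect_preconn a b y0) (tops_preconn j)
    all_goals (try simp only [tpt]); linarith
  refine hc.subset_connectedComponentIn (Or.inr ⟨_, ⟨?_, ?_⟩, rfl⟩) ?_ (Or.inl ⟨h1, h2⟩)
  · linarith
  · linarith
  · have hgap : ∀ w : Strip, w.1 ∈ Ioo (j : ℝ) (j + 1) → w ∉ LL η j ∪ LL η (j + 1) := by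
      rintro w hw (h | h)
      · linarith [hw.1, h.1]
      · have := h.1
        push_cast at this
        linarith [hw.2]
    rintro w (⟨h1, h2⟩ | ⟨x, hx, rfl⟩)
    · exact ⟨hsub w h1 h2, hgap w ⟨by linarith [h1.1], by linarith [h1.2]⟩⟩
    · exact ⟨top_U hX rfl, hgap _ hx⟩

theorem near_LL (hX : IsEAC X Um Up) (hη : etaSpec (pr ⁻¹' X) η) {m : ℤ} {z : Strip}
    (hz : z ∈ LL η m) : ∃ r > 0, (∀ w ∈ Metric.ball z r, w.1 < m → w ∈ CC (pr ⁻¹' Up) η (m - 1)) ∧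
      (∀ w ∈ Metric.ball z r, (m : ℝ) < w.1 → w ∈ CC (pr ⁻¹' Up) η m) ∧
      (∀ w ∈ Metric.ball z r, w.1 = m → w ∈ LL η m) := by
  have hOo : IsOpen (pr ⁻¹' Up ∩ {w : Strip | η < (w.2 : ℝ)}) :=
    (U_open hX).inter (isOpen_lt (by fun_prop) (by fun_prop))
  have hK : IsCompact (({(m : ℝ)} : Set ℝ) ×ˢ (Ici z.2 : Set II)) :=
    isCompact_singleton.prod isClosed_Ici.isCompact
  obtain ⟨δ, hδ, hsub⟩ := hK.exists_thickening_subset_open hOo (by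
    rintro w ⟨h1, h2⟩
    have h2' : (z.2 : ℝ) ≤ w.2 := h2
    have : w ∈ LL η m := ⟨h1, hz.2.trans_le h2'⟩
    exact ⟨LL_sub hX hη m this, this.2⟩)
  have key : ∀ w : Strip, |w.1 - m| < δ → (z.2 : ℝ) - δ < w.2 → w ∈ pr ⁻¹' Up ∧ η < (w.2 : ℝ) := by
    intro w h1 h2
    refine hsub (Metric.mem_thickening_iff.2 ⟨((m : ℝ), max z.2 w.2), ⟨rfl, mem_Ici.2 (le_max_left _ _)⟩, ?_⟩)
    rw [Prod.dist_eq]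
    refine max_lt (by rwa [Real.dist_eq]) ?_
    rcases le_total z.2 w.2 with h | h
    · rw [max_eq_right h, dist_self]; exact hδ
    · rw [max_eq_left h, Subtype.dist_eq, Real.dist_eq, abs_lt]
      have h' : (w.2 : ℝ) ≤ z.2 := h
      constructor <;> linarith
  set r := min δ 1 with hr
  have hr0 : 0 < r := lt_min hδ one_pos
  have hrδ : r ≤ δ := min_le_left _ _
  have hr1 : r ≤ 1 := min_le_right _ _
  have hz1 : (z.2 : ℝ) ≤ 1 := z.2.2.2
  have hball : ∀ w ∈ Metric.ball z r, |w.1 - m| < r ∧ (z.2 : ℝ) - r < w.2 := by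
    intro w hw
    rw [Metric.mem_ball, Prod.dist_eq, max_lt_iff, Real.dist_eq, Subtype.dist_eq, Real.dist_eq,
      hz.1] at hw
    exact ⟨hw.1, by linarith [(abs_lt.1 hw.2).1]⟩
  refine ⟨r, hr0, ?_, ?_, ?_⟩
  · intro w hw hlt
    obtain ⟨h1, h2⟩ := hball w hw
    refine rect_CC hX (a := m - r) (b := m) (y0 := z.2 - r) (by push_cast; linarith) (by linarith)
      (by push_cast; linarith) (by linarith) ?_ ⟨by linarith [(abs_lt.1 h1).1], hlt⟩ h2
    intro w h1 h2
    exact (key w (abs_lt.2 ⟨by linarith [h1.1], by linarith [h1.2]⟩) (by linarith)).1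
  · intro w hw hlt
    obtain ⟨h1, h2⟩ := hball w hw
    refine rect_CC hX (a := m) (b := m + r) (y0 := z.2 - r) le_rfl (by linarith)
      (by linarith) (by linarith) ?_ ⟨hlt, by linarith [(abs_lt.1 h1).2]⟩ h2
    intro w h1 h2
    exact (key w (abs_lt.2 ⟨by linarith [h1.1], by linarith [h1.2]⟩) (by linarith)).1
  · intro w hw he
    obtain ⟨h1, h2⟩ := hball w hw
    exact ⟨he, (key w (by linarith) (by linarith)).2⟩

theorem ball_CC (hX : IsEAC X Um Up) (hη : etaSpec (pr ⁻¹' X) η) {p : Strip}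
    (hp : p ∈ pr ⁻¹' Up \ DD η) : ∃ r > 0, Metric.ball p r ⊆ pr ⁻¹' Up \ DD η ∧
      ∀ w ∈ Metric.ball p r, ∀ j, w ∈ CC (pr ⁻¹' Up) η j → p ∈ CC (pr ⁻¹' Up) η j := by
  obtain ⟨r, hr, hb⟩ := Metric.isOpen_iff.1 (U_DD_open hX hη) p hp
  refine ⟨r, hr, hb, fun w hw j hwj => ?_⟩
  have := (ball_preconn p r).subset_connectedComponentIn (F := pr ⁻¹' Up \ (LL η j ∪ LL η (j + 1)))
    hw (fun v hv => ⟨(hb hv).1, fun h => (hb hv).2 (mem_iUnion.2 (by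
      rcases h with h | h
      exacts [⟨_, h⟩, ⟨_, h⟩]))⟩)
  have h2 := this (Metric.mem_ball_self hr)
  unfold CC at hwj ⊢
  rwa [connectedComponentIn_eq hwj]

theorem cover_CC (hX : IsEAC X Um Up) (hη : etaSpec (pr ⁻¹' X) η) {p : Strip}
    (hp : p ∈ pr ⁻¹' Up) : (∃ j, p ∈ CC (pr ⁻¹' Up) η j) ∨ p ∈ DD η := by
  let W : Set Strip := {p | (∃ j, p ∈ CC (pr ⁻¹' Up) η j) ∨ p ∈ DD η}
  have hWo : IsOpen W := by
    rw [Metric.isOpen_iff]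
    rintro z (⟨j, hz⟩ | hz)
    · obtain ⟨r, hr, hb⟩ := Metric.isOpen_iff.1 (CC_open hX hη j) z hz
      exact ⟨r, hr, fun w hw => Or.inl ⟨j, hb hw⟩⟩
    · obtain ⟨m, hz⟩ := mem_iUnion.1 hz
      obtain ⟨r, hr, h1, h2, h3⟩ := near_LL hX hη hz
      refine ⟨r, hr, fun w hw => ?_⟩
      rcases lt_trichotomy w.1 m with h | h | h
      · exact Or.inl ⟨_, h1 w hw h⟩
      · exact Or.inr (mem_iUnion.2 ⟨m, h3 w hw h⟩)
      · exact Or.inl ⟨_, h2 w hw h⟩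
  have hWc : IsOpen (pr ⁻¹' Up \ W) := by
    rw [Metric.isOpen_iff]
    rintro z ⟨hzU, hzW⟩
    obtain ⟨r, hr, hb, h⟩ := ball_CC hX hη ⟨hzU, fun h => hzW (Or.inr h)⟩
    refine ⟨r, hr, fun w hw => ⟨(hb hw).1, ?_⟩⟩
    rintro (⟨j, hj⟩ | hj)
    · exact hzW (Or.inl ⟨j, h w hw j hj⟩)
    · exact (hb hw).2 hj
  have hWT : ∀ k : ℤ, ∀ z ∈ W, shiftPt k z ∈ W := by
    rintro k z (⟨j, hz⟩ | hz)
    · exact Or.inl ⟨_, shift_CC hX k hz⟩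
    · obtain ⟨m, hz⟩ := mem_iUnion.1 hz
      exact Or.inr (mem_iUnion.2 ⟨m + k, shift_LL.2 hz⟩)
  by_contra hcon
  obtain ⟨a, -, ⟨u, hu, hua⟩, ⟨v, hv, hva⟩⟩ := hX.Up_conn _ _ (pr_open _ hWo) (pr_open _ hWc) (by
    intro a ha
    obtain ⟨z, rfl⟩ := pr_surj a
    by_cases hz : z ∈ W
    · exact Or.inl ⟨z, hz, rfl⟩
    · exact Or.inr ⟨z, ⟨ha, hz⟩, rfl⟩) ⟨pr (tp 0), top_U hX rfl, tp 0, Or.inl ⟨0, tp_CC hX 0⟩, rfl⟩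
    ⟨pr p, hp, p, ⟨hp, hcon⟩, rfl⟩
  obtain ⟨k, rfl⟩ := pr_eq (hua.trans hva.symm)
  exact hv.2 (hWT k u hu)

theorem cover_V (hX : IsEAC X Um Up) (hη : etaSpec (pr ⁻¹' X) η) {p : Strip}
    (hp : p ∈ pr ⁻¹' Up) : ∃ j, p ∈ pr ⁻¹' Up ∩ closure (CC (pr ⁻¹' Up) η j) := by
  rcases cover_CC hX hη hp with ⟨j, h⟩ | h
  · exact ⟨j, hp, subset_closure h⟩
  · obtain ⟨m, h⟩ := mem_iUnion.1 h
    obtain ⟨r, hr, -, h2, -⟩ := near_LL hX hη h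
    refine ⟨m, hp, Metric.mem_closure_iff.2 fun ε hε => ?_⟩
    have hs : 0 < min r ε := lt_min hr hε
    refine ⟨(p.1 + min r ε / 2, p.2), h2 _ ?_ ?_, ?_⟩
    · rw [Metric.mem_ball, Prod.dist_eq, dist_self, Real.dist_eq]
      simp only [add_sub_cancel_left]
      rw [abs_of_pos (by linarith)]
      exact max_lt (by linarith [min_le_left r ε]) hr
    · simp only [h.1]; linarith
    · rw [Prod.dist_eq, dist_self, dist_comm, Real.dist_eq]
      simp only [add_sub_cancel_left]
      rw [abs_of_pos (by linarith)]
      exact max_lt (by linarith [min_le_right r ε]) hε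

theorem reach_LL (hX : IsEAC X Um Up) (hη : etaSpec (pr ⁻¹' X) η) {p : Strip} {j m : ℤ}
    (hp : p ∈ pr ⁻¹' Up ∩ closure (CC (pr ⁻¹' Up) η j)) (hpm : p ∉ LL η m) :
    tp j = p ∨ ArcIn (pr ⁻¹' Up \ LL η m) (tp j) p := by
  obtain ⟨r, hr, hb⟩ := Metric.isOpen_iff.1 (U_LL_open hX hη m) p ⟨hp.1, hpm⟩
  obtain ⟨w, hw, hd⟩ := Metric.mem_closure_iff.1 hp.2 r hr
  have hwb : w ∈ Metric.ball p r := by rwa [Metric.mem_ball, dist_comm]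
  refine arc_conn (U_LL_open hX hη m)
    (IsPreconnected.union w hw hwb (CC_preconn j) (ball_preconn p r)) ?_
    (Or.inl (tp_CC hX j)) (Or.inr (Metric.mem_ball_self hr))
  rintro v (hv | hv)
  · exact ⟨(CC_sub j hv).1, CC_avoid hX hη hv⟩
  · exact hb hv

theorem reach_DD (hX : IsEAC X Um Up) (hη : etaSpec (pr ⁻¹' X) η) {p : Strip}
    (hp : p ∈ pr ⁻¹' Up \ DD η) :
    ∃ j, tp j = p ∨ ArcIn (pr ⁻¹' Up \ DD η) (tp j) p := by
  obtain ⟨j, hj⟩ := (cover_CC hX hη hp.1).resolve_right hp.2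
  exact ⟨j, arc_conn (U_DD_open hX hη) (CC_preconn j) (CC_DD hX hη j) (tp_CC hX j) hj⟩

end Regions


section Main
variable {X Um Up : Set Ann} {η : ℝ}

theorem tail_closed {δ : unitInterval → Strip} (hδ : Continuous δ) {K : Set Strip} (hK : IsClosed K)
    (h1 : δ 1 ∉ K) : ∃ t0 : unitInterval, t0 ≠ 1 ∧ ∀ t, t0 ≤ t → δ t ∉ K := by
  have ho : IsOpen (δ ⁻¹' Kᶜ) := hK.isOpen_compl.preimage hδ
  obtain ⟨r, hr, hb⟩ := Metric.isOpen_iff.1 ho 1 h1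
  have hmem : max 0 (1 - r / 2) ∈ Icc (0 : ℝ) 1 := ⟨le_max_left _ _, max_le zero_le_one (by linarith)⟩
  refine ⟨⟨max 0 (1 - r / 2), hmem⟩, fun h => ?_, fun t ht => ?_⟩
  · have h2 : max 0 (1 - r / 2) = (1 : ℝ) := congrArg Subtype.val h
    have h3 : max 0 (1 - r / 2) < (1 : ℝ) := max_lt one_pos (by linarith)
    linarith
  · have h2 : max 0 (1 - r / 2) ≤ (t : ℝ) := ht
    have h3 : 1 - r / 2 ≤ (t : ℝ) := (le_max_right _ _).trans h2
    refine hb ?_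
    rw [Metric.mem_ball, Subtype.dist_eq, Real.dist_eq, abs_lt]
    have := t.2.2
    constructor <;> simp <;> linarith

theorem eq_ept (hX : IsEAC X Um Up) (hη : etaSpec (pr ⁻¹' X) η) {e : Strip} {m : ℤ}
    (he : e ∈ pr ⁻¹' X) (h1 : e.1 = m) (h2 : η ≤ (e.2 : ℝ)) : e = ept η m := by
  have hm := eta_mem hX hη
  have h3 := le_eta hη he h1
  refine Prod.ext h1 (Subtype.ext ?_)
  simp only [ept]
  rw [projIcc_of_mem _ ⟨hm.1.le, hm.2.le⟩]
  exact le_antisymm h3 h2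

theorem tail_LL (hX : IsEAC X Um Up) (hη : etaSpec (pr ⁻¹' X) η) {δ : unitInterval → Strip}
    {e : Strip} {m : ℤ} (hδ : IsArcTo (pr ⁻¹' Up) δ e) (he : e ∈ pr ⁻¹' X) (hne : e ≠ ept η m) :
    ∃ t0 : unitInterval, t0 ≠ 1 ∧ ∀ t, t0 ≤ t → t ≠ 1 → δ t ∈ pr ⁻¹' Up \ LL η m := by
  have h1 : IsClosed {z : Strip | z.1 = (m : ℝ)} := isClosed_eq (by fun_prop) (by fun_prop)
  have h2 : IsClosed {z : Strip | η ≤ (z.2 : ℝ)} := isClosed_le (by fun_prop) (by fun_prop)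
  obtain ⟨t0, h3, h4⟩ := tail_closed hδ.1 (h1.inter h2) (by
    rw [hδ.2.2.2]
    rintro ⟨h, h'⟩
    exact hne (eq_ept hX hη he h h'))
  exact ⟨t0, h3, fun t ht ht1 => ⟨hδ.2.2.1 t ht1, fun h => h4 t ht ⟨h.1, h.2.le⟩⟩⟩

theorem tail_DD (hX : IsEAC X Um Up) (hη : etaSpec (pr ⁻¹' X) η) {δ : unitInterval → Strip}
    {e : Strip} (hδ : IsArcTo (pr ⁻¹' Up) δ e) (he : e ∈ pr ⁻¹' X) (hne : ∀ m, e ≠ ept η m) :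
    ∃ t0 : unitInterval, t0 ≠ 1 ∧ ∀ t, t0 ≤ t → t ≠ 1 → δ t ∈ pr ⁻¹' Up \ DD η := by
  have h1 : IsClosed ((Prod.fst : Strip → ℝ) ⁻¹' (range ((↑) : ℤ → ℝ))) :=
    Int.isClosedEmbedding_coe_real.isClosed_range.preimage continuous_fst
  have h2 : IsClosed {z : Strip | η ≤ (z.2 : ℝ)} := isClosed_le (by fun_prop) (by fun_prop)
  obtain ⟨t0, h3, h4⟩ := tail_closed hδ.1 (h1.inter h2) (by
    rw [hδ.2.2.2]
    rintro ⟨⟨m, h⟩, h'⟩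
    exact hne m (eq_ept hX hη he h.symm h'))
  refine ⟨t0, h3, fun t ht ht1 => ⟨hδ.2.2.1 t ht1, fun h => ?_⟩⟩
  obtain ⟨m, h⟩ := mem_iUnion.1 h
  exact h4 t ht ⟨⟨m, h.1.symm⟩, h.2.le⟩

/-- an access arc avoiding the line `m`, with given germ, starting at `q` -/
def LArc (U : Set Strip) (η : ℝ) (m : ℤ) (ε δ : unitInterval → Strip) (e : Strip) : Prop :=
  TAcc U ε e ∧ Germ ε δ ∧ ∀ t, t ≠ 1 → ε t ∈ U \ LL η m

theorem exists_arc_at (hX : IsEAC X Um Up) (hη : etaSpec (pr ⁻¹' X) η) {δ : unitInterval → Strip}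
    {e : Strip} {m j : ℤ} (hδ : IsArcTo (pr ⁻¹' Up) δ e) (he : e ∈ pr ⁻¹' X)
    {t0 : unitInterval} (ht0 : t0 ≠ 1) (h : ∀ t, t0 ≤ t → t ≠ 1 → δ t ∈ pr ⁻¹' Up \ LL η m)
    (hj : δ t0 ∈ closure (CC (pr ⁻¹' Up) η j)) :
    ∃ ε, LArc (pr ⁻¹' Up) η m ε δ e ∧ ε 0 = tp j := by
  have h0 := h t0 le_rfl ht0
  obtain ⟨ε, h1, h2, h3, h4⟩ := glue (O := pr ⁻¹' Up \ LL η m) (fun z hz => hz.1) (X_not_U hX he) hδ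
    ht0 h (q := tp j) rfl ⟨top_U hX rfl, tp_not_LL _ _⟩ (reach_LL hX hη ⟨h0.1, hj⟩ h0.2)
  exact ⟨ε, ⟨h1, h3, h4⟩, h2⟩

theorem exists_arc (hX : IsEAC X Um Up) (hη : etaSpec (pr ⁻¹' X) η) {δ : unitInterval → Strip}
    {e : Strip} {m : ℤ} (hδ : IsArcTo (pr ⁻¹' Up) δ e) (he : e ∈ pr ⁻¹' X) (hne : e ≠ ept η m) :
    ∃ ε j, LArc (pr ⁻¹' Up) η m ε δ e ∧ ε 0 = tp j := by
  obtain ⟨t0, h1, h2⟩ := tail_LL hX hη hδ he hne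
  obtain ⟨j, hj⟩ := cover_V hX hη (h2 t0 le_rfl h1).1
  obtain ⟨ε, h⟩ := exists_arc_at hX hη hδ he h1 h2 hj.2
  exact ⟨ε, j, h⟩

theorem exists_arc_D (hX : IsEAC X Um Up) (hη : etaSpec (pr ⁻¹' X) η) {δ : unitInterval → Strip}
    {e : Strip} (hδ : IsArcTo (pr ⁻¹' Up) δ e) (he : e ∈ pr ⁻¹' X) (hne : ∀ m, e ≠ ept η m) :
    ∃ ε j, (∀ m, LArc (pr ⁻¹' Up) η m ε δ e) ∧ ε 0 = tp j := by
  obtain ⟨t0, h1, h2⟩ := tail_DD hX hη hδ he hne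
  obtain ⟨j, hj⟩ := reach_DD hX hη (h2 t0 le_rfl h1)
  obtain ⟨ε, g1, g2, g3, g4⟩ := glue (O := pr ⁻¹' Up \ DD η) (fun z hz => hz.1) (X_not_U hX he) hδ
    h1 h2 (q := tp j) rfl (CC_DD hX hη j (tp_CC hX j)) hj
  exact ⟨ε, j, fun m => ⟨g1, g3, fun t ht => ⟨(g4 t ht).1, fun h => (g4 t ht).2
    (mem_iUnion.2 ⟨m, h⟩)⟩⟩, g2⟩

theorem arcs_disj (hX : IsEAC X Um Up) (hη : etaSpec (pr ⁻¹' X) η) {ε ε' δ δ' : unitInterval → Strip}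
    {e e' : Strip} {m : ℤ} (h : LArc (pr ⁻¹' Up) η m ε δ e) (h' : LArc (pr ⁻¹' Up) η m ε' δ' e')
    (he : e ∈ pr ⁻¹' X) (he' : e' ∈ pr ⁻¹' X) (hne : e ≠ e') (hl : (ε 0).1 < m)
    (hr : m < (ε' 0).1) : ∀ s t, ε s ≠ ε' t := by
  intro s t hst
  have hs : s ≠ 1 := by
    rintro rfl
    rw [h.1.1.2.2.2] at hst
    by_cases ht : t = 1
    · rw [ht, h'.1.1.2.2.2] at hst; exact hne hst
    · exact X_not_U hX he (hst ▸ (h'.2.2 t ht).1)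
  have ht : t ≠ 1 := by
    rintro rfl
    rw [h'.1.1.2.2.2] at hst
    exact X_not_U hX he' (hst ▸ (h.2.2 s hs).1)
  have hlt : ∀ {u v : unitInterval}, v ≠ 1 → u ≤ v → u ≠ 1 := by
    rintro u v hv huv rfl
    exact hv (le_antisymm v.2.2 huv)
  have hpc : IsPreconnected (ε '' Icc 0 s ∪ ε' '' Icc 0 t) :=
    IsPreconnected.union (ε s) ⟨s, ⟨s.2.1, le_rfl⟩, rfl⟩ ⟨t, ⟨t.2.1, le_rfl⟩, hst.symm⟩
      (isPreconnected_Icc.image _ h.1.1.1.continuousOn)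
      (isPreconnected_Icc.image _ h'.1.1.1.continuousOn)
  have hJ := path_conn (U_LL_open hX hη m) hpc (by
    rintro _ (⟨u, hu, rfl⟩ | ⟨u, hu, rfl⟩)
    · exact h.2.2 u (hlt hs hu.2)
    · exact h'.2.2 u (hlt ht hu.2)) (p := ε 0) (q := ε' 0)
    (Or.inl ⟨0, ⟨le_rfl, s.2.1⟩, rfl⟩) (Or.inr ⟨0, ⟨le_rfl, t.2.1⟩, rfl⟩)
  exact nosep hX hη hJ h.1.2 h'.1.2 hl hr

theorem line_disj (hX : IsEAC X Um Up) (hη : etaSpec (pr ⁻¹' X) η) {ε δ : unitInterval → Strip}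
    {e : Strip} {m : ℤ} (h : LArc (pr ⁻¹' Up) η m ε δ e) (he : e ∈ pr ⁻¹' X) (hne : e ≠ ept η m) :
    ∀ s t, bl η m s ≠ ε t := by
  intro s t hst
  by_cases hs : s = 1
  · rw [hs, (bl_acc hX hη m).1.2.2.2] at hst
    by_cases ht : t = 1
    · rw [ht, h.1.1.2.2.2] at hst; exact hne hst.symm
    · exact X_not_U hX (ept_mem hX hη m) (hst ▸ (h.2.2 t ht).1)
  · have hb := bl_mem hX hη m hs
    by_cases ht : t = 1
    · rw [ht, h.1.1.2.2.2] at hst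
      exact X_not_U hX he (hst ▸ LL_sub hX hη m hb)
    · exact (h.2.2 t ht).2 (hst ▸ hb)

theorem precB_of {U : Set Strip} {γ γ' : unitInterval → Strip} {a b : Strip} (h : TAcc U γ a)
    (h' : TAcc U γ' b) (hd : ∀ s t, γ s ≠ γ' t) (hlt : (γ 0).1 < (γ' 0).1) : PrecB 1 U a b :=
  ⟨γ, γ', h.1, h'.1, h.2, h'.2, Set.disjoint_left.2 (by
    rintro _ ⟨s, rfl⟩ ⟨t, ht⟩
    exact hd s t ht.symm), hlt⟩

theorem shift_ept (k m : ℤ) : shiftPt k (ept η m) = ept η (m + k) := by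
  unfold shiftPt ept
  refine Prod.ext ?_ rfl
  push_cast; rfl

theorem bl_zero (m : ℤ) : (bl η m 0).1 = m := rfl

section Dyn
variable {f : Ann ≃ₜ Ann} {F : Strip ≃ₜ Strip}

theorem F_TAcc (hf : IsotopicToId ⇑f) (hF : IsLift ⇑f ⇑F) (hX : IsEAC X Um Up) (hinv : ⇑f '' X = X)
    {γ : unitInterval → Strip} {a : Strip} (h : TAcc (pr ⁻¹' Up) γ a) (n : ℕ) :
    TAcc (pr ⁻¹' Up) (fun t => F^[n] (γ t)) (F^[n] a) := by
  induction n with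
  | zero => exact h
  | succ n ih =>
    simp only [iterate_succ_apply']
    obtain ⟨⟨h1, h2, h3, h4⟩, h5⟩ := ih
    exact ⟨⟨F.continuous.comp h1, F.injective.comp h2, fun t ht => F_Ut hf hF hX hinv (h3 t ht),
      congrArg F h4⟩, F_top hf hF h5⟩

theorem Fn_mono (hf : IsotopicToId ⇑f) (hF : IsLift ⇑f ⇑F) {z w : Strip} (hz : (z.2 : ℝ) = 1)
    (hw : (w.2 : ℝ) = 1) (h : z.1 < w.1) (n : ℕ) :
    ((F^[n] z).2 : ℝ) = 1 ∧ ((F^[n] w).2 : ℝ) = 1 ∧ (F^[n] z).1 < (F^[n] w).1 := by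
  induction n with
  | zero => exact ⟨hz, hw, h⟩
  | succ n ih =>
    simp only [iterate_succ_apply']
    exact ⟨F_top hf hF ih.1, F_top hf hF ih.2.1, F_mono hf hF ih.1 ih.2.1 ih.2.2⟩

theorem Fn_X (hF : IsLift ⇑f ⇑F) (hinv : ⇑f '' X = X)
    (hdisp : ∀ z ∈ pr ⁻¹' X, (F z).1 ≥ z.1 + 1) {z : Strip} (hz : z ∈ pr ⁻¹' X) (n : ℕ) :
    F^[n] z ∈ pr ⁻¹' X ∧ z.1 + n ≤ (F^[n] z).1 := by
  induction n with
  | zero => exact ⟨hz, by simp⟩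
  | succ n ih =>
    simp only [iterate_succ_apply']
    refine ⟨F_Xt hF hinv ih.1, ?_⟩
    have := hdisp _ ih.1
    push_cast
    linarith [ih.2]

theorem tp_lt {j m : ℤ} (h : j < m) : (tp j).1 < m := by
  have : ((j + 1 : ℤ) : ℝ) ≤ m := by exact_mod_cast h
  push_cast at this
  simp only [tp, tpt]
  linarith

theorem tp_gt {j m : ℤ} (h : m ≤ j) : m < (tp j).1 := by
  have : (m : ℝ) ≤ j := by exact_mod_cast h
  simp only [tp, tpt]
  linarith

theorem no_left (hf : IsotopicToId ⇑f) (hF : IsLift ⇑f ⇑F) (hX : IsEAC X Um Up)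
    (hinv : ⇑f '' X = X) (hη : etaSpec (pr ⁻¹' X) η)
    (hdisp : ∀ z ∈ pr ⁻¹' X, (F z).1 ≥ z.1 + 1) {m : ℤ} {x : Strip} (hx : x ∈ pr ⁻¹' X)
    (hxm : x ≠ ept η m) {α0 α1 δ δ' : unitInterval → Strip} (h0 : LArc (pr ⁻¹' Up) η m α0 δ x)
    (h1 : LArc (pr ⁻¹' Up) η m α1 δ' (F x)) (hg : Germ α1 (fun t => F (α0 t)))
    (hl : (α0 0).1 < m) (hr : m < (α1 0).1) (n : ℕ) (ε : unitInterval → Strip)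
    (hε : LArc (pr ⁻¹' Up) η m ε (fun t => F^[n + 1] (bl η m t)) (F^[n + 1] (ept η m))) :
    ¬ (ε 0).1 < m := by
  have hy := ept_mem hX hη m
  have hym : ∀ n : ℕ, F^[n + 1] (ept η m) ≠ ept η m := by
    intro n h
    have := (Fn_X hF hinv hdisp hy (n + 1)).2
    rw [h] at this
    push_cast at this
    have h0 : (0 : ℝ) ≤ n := n.cast_nonneg
    linarith
  have hbl := bl_acc hX hη m
  have base : ∀ ε, LArc (pr ⁻¹' Up) η m ε (fun t => F^[0 + 1] (bl η m t)) (F^[0 + 1] (ept η m)) →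
      ¬ (ε 0).1 < m := by
    intro ε hε hlt
    have hFx := F_Xt hF hinv hx
    have hFy := F_Xt hF hinv hy
    refine contra_arcs hX hFx hFy (F_TAcc hf hF hX hinv h0.1 1) (F_TAcc hf hF hX hinv hbl 1) h1.1
      hε.1 hg.symm hε.2.1.symm ?_ ?_ ?_ (hlt.trans hr)
    · intro s t e
      exact line_disj hX hη h0 hx hxm t s (F.injective e).symm
    · intro s t e
      exact arcs_disj hX hη hε h1 hFy hFx (fun h => hxm (F.injective h).symm) hlt hr t s e.symm
    · exact (Fn_mono hf hF h0.1.2 hbl.2 (by simpa [bl_zero] using hl) 1).2.2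
  induction n generalizing ε with
  | zero => exact base ε hε
  | succ n ih =>
    intro hlt
    obtain ⟨ε1, j1, g1, s1⟩ := exists_arc hX hη (F_TAcc hf hF hX hinv hbl 1).1
      (Fn_X hF hinv hdisp hy 1).1 (hym 0)
    obtain ⟨εn, jn, gn, sn⟩ := exists_arc hX hη (F_TAcc hf hF hX hinv hbl (n + 1)).1
      (Fn_X hF hinv hdisp hy (n + 1)).1 (hym n)
    have b1 : (m : ℝ) < (ε1 0).1 := by
      have := base ε1 g1
      rw [s1] at this ⊢
      exact tp_gt (not_lt.1 fun h => this (tp_lt h))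
    have bn : (m : ℝ) < (εn 0).1 := by
      have := ih εn gn
      rw [sn] at this ⊢
      exact tp_gt (not_lt.1 fun h => this (tp_lt h))
    have hn1 := (Fn_X hF hinv hdisp hy (n + 1)).1
    have hn2 := (Fn_X hF hinv hdisp hy (n + 1 + 1)).1
    have hne : F^[n + 1 + 1] (ept η m) ≠ F^[n + 1] (ept η m) := by
      intro h
      rw [iterate_succ_apply'] at h
      have := hdisp _ hn1
      rw [h] at this
      linarith
    have e2 : ∀ z, F^[n + 1] (F^[1] z) = F^[n + 1 + 1] z := fun z => rfl
    have hB := F_TAcc hf hF hX hinv g1.1 (n + 1)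
    rw [e2] at hB
    refine contra_arcs hX hn1 hn2 (F_TAcc hf hF hX hinv hbl (n + 1)) hB
      gn.1 hε.1 gn.2.1.symm ((g1.2.1.map (F^[n + 1])).trans hε.2.1.symm) ?_ ?_ ?_ (hlt.trans bn)
    · intro s t e
      exact line_disj hX hη g1 (Fn_X hF hinv hdisp hy 1).1 (hym 0) s t (F.injective.iterate _ e)
    · intro s t e
      exact arcs_disj hX hη hε gn hn2 hn1 hne hlt bn t s e.symm
    · exact (Fn_mono hf hF hbl.2 g1.1.2 (by simpa [bl_zero] using b1) (n + 1)).2.2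

theorem rot_nonneg (hf : IsotopicToId ⇑f) (hF : IsLift ⇑f ⇑F) (hX : IsEAC X Um Up)
    (hinv : ⇑f '' X = X) (hη : etaSpec (pr ⁻¹' X) η)
    (hdisp : ∀ z ∈ pr ⁻¹' X, (F z).1 ≥ z.1 + 1) {m : ℤ} {ρ : ℝ}
    (hrot : PrimeEndRotB 1 (pr ⁻¹' Up) (pr ⁻¹' X) ⇑F ρ)
    (hno : ∀ (n : ℕ) (ε : unitInterval → Strip),
      LArc (pr ⁻¹' Up) η m ε (fun t => F^[n + 1] (bl η m t)) (F^[n + 1] (ept η m)) →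
      ¬ (ε 0).1 < m) : 0 ≤ ρ := by
  have hy := ept_mem hX hη m
  have hbl := bl_acc hX hη m
  have key : ∀ n : ℕ, ∃ k : ℤ, 0 ≤ k ∧ AccIdxB 1 (pr ⁻¹' Up) (F^[n] (ept η m)) (ept η m) k := by
    intro n
    have hn := Fn_X hF hinv hdisp hy n
    by_cases h : ∃ l : ℤ, F^[n] (ept η m) = ept η l
    · obtain ⟨l, hl⟩ := h
      have hml : m ≤ l := by
        have h1 := hn.2
        rw [hl] at h1
        have h2 : (m : ℝ) + n ≤ l := h1
        have h3 : (0 : ℝ) ≤ n := n.cast_nonneg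
        have : (m : ℝ) ≤ l := by linarith
        exact_mod_cast this
      refine ⟨l - m, by omega, Or.inl ?_, ?_⟩
      · rw [shift_ept, hl]; congr 1; ring
      · rw [shift_ept, hl, show m + (l - m + 1) = l + 1 by ring]
        refine precB_of (bl_acc hX hη l) (bl_acc hX hη (l + 1)) ?_ ?_
        · intro s t e
          have : (l : ℝ) = ((l + 1 : ℤ) : ℝ) := congrArg Prod.fst e
          push_cast at this
          linarith
        · rw [bl_zero, bl_zero]; push_cast; linarith
    · push Not at h
      obtain ⟨ε, j, h1, h2⟩ := exists_arc_D hX hη (F_TAcc hf hF hX hinv hbl n).1 hn.1 h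
      have hmj : m ≤ j := by
        by_contra hcon
        have hlt : (ε 0).1 < m := by rw [h2]; exact tp_lt (not_le.1 hcon)
        cases n with
        | zero => exact h m rfl
        | succ n => exact hno n ε (h1 m) hlt
      refine ⟨j - m, by omega, Or.inr ?_, ?_⟩
      · rw [shift_ept, show m + (j - m) = j by ring]
        exact precB_of (bl_acc hX hη j) (h1 j).1 (line_disj hX hη (h1 j) hn.1 (h j))
          (by rw [h2, bl_zero]; exact tp_gt le_rfl)
      · rw [shift_ept, show m + (j - m + 1) = j + 1 by ring]
        exact precB_of (h1 j).1 (bl_acc hX hη (j + 1))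
          (fun s t e => line_disj hX hη (h1 (j + 1)) hn.1 (h (j + 1)) t s e.symm)
          (by rw [h2, bl_zero]; exact tp_lt (by omega))
  choose k hk0 hk using key
  have hacc : AccFrom (pr ⁻¹' Up) (ept η m) := ⟨_, hbl.1⟩
  refine ge_of_tendsto' (hrot _ hy _ hy hacc hacc k hk) fun n => ?_
  have : (0 : ℝ) ≤ k n := by exact_mod_cast hk0 n
  positivity

end Dyn
end Main

/-- invariance of the family `𝒜` in Case (iii): the image under `f̃` of a
crosscut of `Ũ₊` with interior in `(V+k)⁻` and `min(c)₁ ≥ R + k` is again such a crosscut,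
with `min(f̃(c))₁ > R + k`. -/
theorem crosscut_family_invariant
    (f : Ann ≃ₜ Ann) (hf : IsotopicToId ⇑f)
    (F : Strip ≃ₜ Strip) (hF : IsLift ⇑f ⇑F)
    (X Um Up : Set Ann) (hX : IsEAC X Um Up) (hinv : ⇑f '' X = X)
    (φ : Ann → ℝ) (hφc : Continuous φ)
    (hφ : ∀ z : Strip, φ (pr z) = (F z).1 - z.1)
    (η : ℝ) (hη : etaSpec (pr ⁻¹' X) η)
    (hbelow : ¬ BddBelow (Prod.fst '' Vset (pr ⁻¹' Up) η))
    (habove : ¬ BddAbove (Prod.fst '' Vset (pr ⁻¹' Up) η))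
    -- (a) prime end rotation number `< 0` and `inf ρ_mes > 0`
    (ρ : ℝ) (hρneg : ρ < 0)
    (hrot : PrimeEndRotB 1 (pr ⁻¹' Up) (pr ⁻¹' X) ⇑F ρ)
    (hpos : 0 < sInf (rotMes ⇑f φ X))
    -- (b) displacement at least `1` on `X̃`
    (hdisp : ∀ z ∈ pr ⁻¹' X, (F z).1 ≥ z.1 + 1)
    -- (c) the constant `M` of Lemma `aladerecha`
    (M : ℝ) (hM : M > 1)
    (hMprop : ∀ x ∈ Vset (pr ⁻¹' Up) η,
      (∀ γ : unitInterval → Strip, IsHair (Vset (pr ⁻¹' Up) η) γ → γ 1 = x →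
        sSup (proj1 γ) - sInf (proj1 γ) > M) →
      (F x).1 ≥ x.1 + 1 / 2)
    -- (d) the constant `R` of Lemma `pasaporizquierda` applied to `L = -M`
    (R : ℝ) (hR : R > 1)
    (hRprop : ∀ k : ℤ, k ≤ 0 → ∀ γ : unitInterval → Strip,
      IsHair (shiftSet k (Vset (pr ⁻¹' Up) η)) γ → (γ 1).1 ≥ R → -M ∈ proj1 γ) :
    ∀ k : ℤ, ∀ c : unitInterval → Strip,
      IsCrosscut (pr ⁻¹' Up) (pr ⁻¹' X) c →
      (∀ t, t ≠ 0 → t ≠ 1 → c t ∈ VMinus k (Vset (pr ⁻¹' Up) η)) →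
      sInf (proj1 c) ≥ R + k →
      IsCrosscut (pr ⁻¹' Up) (pr ⁻¹' X) (fun t => F (c t)) ∧
      (∀ t, t ≠ 0 → t ≠ 1 → F (c t) ∈ VMinus k (Vset (pr ⁻¹' Up) η)) ∧
      sInf (proj1 fun t => F (c t)) > R + k := by
  intro k c hc hcV hcR
  obtain ⟨hcc, hci, hc0, hc1, hcU⟩ := hc
  have hbdd : ∀ g : unitInterval → Strip, Continuous g →
      BddBelow (proj1 g) ∧ BddAbove (proj1 g) := by
    intro g hg
    have : IsCompact (proj1 g) := isCompact_range (continuous_fst.comp hg)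
    exact ⟨this.bddBelow, this.bddAbove⟩
  have hcR' : ∀ t, R + k ≤ (c t).1 := fun t =>
    hcR.le.trans (csInf_le (hbdd c hcc).1 ⟨t, rfl⟩)
  have hmove : ∀ t, (c t).1 + 1 / 2 ≤ (F (c t)).1 := by
    intro t
    by_cases ht0 : t = 0
    · have := hdisp _ hc0
      rw [ht0]; linarith
    by_cases ht1 : t = 1
    · have := hdisp _ hc1
      rw [ht1]; linarith
    have hv := hcV t ht0 ht1
    simp only [VMinus, mem_iUnion] at hv
    obtain ⟨j, hj, w, hw, hwe⟩ := hv
    have hjk : j ≤ k := hj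
    have hwR := hcR' t
    have hw1 : (c t).1 = w.1 + j := by rw [← hwe]; rfl
    have h1 := hMprop w hw (by
      intro γ hγ hγ1
      obtain ⟨g1, g2, g3, g4⟩ := hγ
      obtain ⟨s, hs⟩ := hRprop (j - k) (by omega) (fun t => shiftPt (j - k) (γ t))
        ⟨(shift_continuous _).comp g1, fun a b e => g2 (by
          have e1 := congrArg Prod.fst e
          have e2 := congrArg Prod.snd e
          simp only [shiftPt] at e1 e2
          exact Prod.ext (by linarith) e2), g3, fun t => ⟨_, g4 t, rfl⟩⟩ (by
          simp only [shiftPt, hγ1]; push_cast; linarith)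
      simp only [shiftPt] at hs
      push_cast at hs
      have a1 := csInf_le (hbdd γ g1).1 ⟨s, rfl⟩
      have a2 := le_csSup (hbdd γ g1).2 ⟨1, rfl⟩
      simp only [hγ1] at a1 a2
      linarith)
    have h2 : (F (c t)).1 = (F w).1 + j := by
      rw [← hwe, F_shift hF]; rfl
    linarith
  have hFc : Continuous fun t => F (c t) := F.continuous.comp hcc
  refine ⟨⟨hFc, F.injective.comp hci, F_Xt hF hinv hc0, F_Xt hF hinv hc1,
    fun t h0 h1 => F_Ut hf hF hX hinv (hcU t h0 h1)⟩, ?_, ?_⟩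
  · intro t1 ht0 ht1
    by_contra hcon
    have hFU := F_Ut hf hF hX hinv (hcU t1 ht0 ht1)
    have hp0 : (0 : ℝ) < t1 := lt_of_le_of_ne t1.2.1 (fun h => ht0 (Subtype.ext h.symm))
    have hp1 : (t1 : ℝ) < 1 := lt_of_le_of_ne t1.2.2 (fun h => ht1 (Subtype.ext h))
    have hv := hcV t1 ht0 ht1
    simp only [VMinus, mem_iUnion] at hv hcon
    obtain ⟨j, hj, hjc⟩ := hv
    have hjk : j ≤ k := hj
    rw [shift_Vset hX] at hjc
    obtain ⟨j', hj'⟩ := cover_V hX hη hFU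
    have hjk' : k + 1 ≤ j' := by
      by_contra h
      exact hcon ⟨j', mem_Iic.2 (by omega), by rw [shift_Vset hX]; exact hj'⟩
    let δ : unitInterval → Strip := fun t => c (t1 * unitInterval.symm t)
    have hδ0 : δ 0 = c t1 := by simp [δ]
    have hδ1 : δ 1 = c 0 := by simp [δ]
    have hpar : ∀ t : unitInterval, t ≠ 1 →
        t1 * unitInterval.symm t ≠ 0 ∧ t1 * unitInterval.symm t ≠ 1 := by
      intro t ht
      have h1 : (t : ℝ) < 1 := lt_of_le_of_ne t.2.2 (fun h => ht (Subtype.ext h))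
      have h0 : (0 : ℝ) ≤ t := t.2.1
      constructor
      · intro h
        have := congrArg Subtype.val h
        simp at this
        rcases this with h | h
        · exact ht0 h
        · exact ht (Subtype.ext (by simp; linarith))
      · intro h
        have h2 : (t1 : ℝ) * (1 - t) = 1 := congrArg Subtype.val h
        nlinarith
    have hδ : IsArcTo (pr ⁻¹' Up) δ (c 0) := by
      refine ⟨hcc.comp (by fun_prop), ?_, fun t ht => hcU _ (hpar t ht).1 (hpar t ht).2, hδ1⟩
      intro s t e
      have h1 := hci e
      have h2 : (t1 : ℝ) * (1 - s) = t1 * (1 - t) := congrArg Subtype.val h1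
      have h3 := mul_left_cancel₀ hp0.ne' h2
      exact Subtype.ext (by linarith)
    have hFδ : IsArcTo (pr ⁻¹' Up) (fun t => F (δ t)) (F (c 0)) :=
      ⟨F.continuous.comp hδ.1, F.injective.comp hδ.2.1,
        fun t ht => F_Ut hf hF hX hinv (hδ.2.2.1 t ht), congrArg F hδ.2.2.2⟩
    have hgt : ∀ t, ((k + 1 : ℤ) : ℝ) < (c t).1 := by
      intro t
      have := hcR' t
      push_cast; linarith
    have hav : ∀ z : Strip, ((k + 1 : ℤ) : ℝ) < z.1 → z ∉ LL η (k + 1) := fun z hz h =>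
      hz.ne h.1.symm
    obtain ⟨α0, a0, b0⟩ := exists_arc_at hX hη (m := k + 1) (j := j) hδ hc0
      (t0 := 0) zero_ne_one (fun t _ ht => ⟨hδ.2.2.1 t ht, hav _ (hgt _)⟩)
      (by rw [hδ0]; exact hjc.2)
    obtain ⟨α1, a1, b1⟩ := exists_arc_at hX hη (m := k + 1) (j := j') hFδ (F_Xt hF hinv hc0)
      (t0 := 0) zero_ne_one (fun t _ ht => ⟨hFδ.2.2.1 t ht, hav _ (by
        have h1 := hgt (t1 * unitInterval.symm t)
        have h2 := hmove (t1 * unitInterval.symm t)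
        have h3 : F (δ t) = F (c (t1 * unitInterval.symm t)) := rfl
        rw [h3]; linarith)⟩)
      (by rw [hδ0]; exact hj'.2)
    have hxm : c 0 ≠ ept η (k + 1) := by
      intro h
      have h1 := hgt 0
      rw [h] at h1
      exact lt_irrefl _ h1
    have := rot_nonneg hf hF hX hinv hη hdisp hrot
      (no_left hf hF hX hinv hη hdisp hc0 hxm a0 a1 (a1.2.1.trans (a0.2.1.symm.map F))
        (by rw [b0]; exact tp_lt (by omega)) (by rw [b1]; exact tp_gt hjk'))
    linarith
  · have : R + k + 1 / 2 ≤ sInf (proj1 fun t => F (c t)) := by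
      refine le_csInf ⟨_, 0, rfl⟩ ?_
      rintro _ ⟨t, rfl⟩
      have h1 := hmove t
      have h2 := hcR' t
      simp only
      linarith
    linarith
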